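/- For every integer n ≥ 3 there exists a continuum K such that: (i) K is simple-n-od-like; (ii) K is not simple-(n−1)-od-like; and (iii) every proper nondegenerate subcontinuum of K is an arc. -/

import Mathlib

/-! ## Simple-n-ods in the plane, likeness, arcs, triods, indecomposability -/

/-- The simple-`n`-od `T_n ⊆ ℂ`: the union of `n` unit segments emanating from `0`. -/
def simpleOdSet (n : ℕ) : Set ℂ :=
  {z | ∃ t : ℝ, ∃ k : ℕ, t ∈ Set.Icc (0:ℝ) 1 ∧ k < n ∧
    z = (t : ℂ) * Complex.exp (2 * Real.pi * Complex.I * (k : ℂ) / (n : ℂ))}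

/-- `X` is `Y`-like: for every `ε > 0` there is a continuous surjection `X → Y`
all of whose point-inverses have diameter `< ε`. -/
def IsLike (X Y : Type*) [MetricSpace X] [MetricSpace Y] : Prop :=
  ∀ ε : ℝ, 0 < ε → ∃ g : X → Y, Continuous g ∧ Function.Surjective g ∧
    ∀ y : Y, Metric.diam (g ⁻¹' {y}) < ε

/-- `A` is an arc: it is homeomorphic to `[0,1]`. -/
def IsArcSet {K : Type*} [TopologicalSpace K] (A : Set K) : Prop :=
  Nonempty (↥A ≃ₜ ↥(Set.Icc (0:ℝ) 1))

/-- Two sets are mutually separated: neither meets the closure of the other. -/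
def MutuallySeparated {K : Type*} [TopologicalSpace K] (A B : Set K) : Prop :=
  A ∩ closure B = ∅ ∧ closure A ∩ B = ∅

/-- The (sub)continuum `C` is a triod: it contains a subcontinuum `M` such that
`C \ M` is the union of three nonempty pairwise mutually separated sets. -/
def IsTriodSet {K : Type*} [TopologicalSpace K] (C : Set K) : Prop :=
  ∃ M A B D : Set K, IsCompact M ∧ IsConnected M ∧ M ⊆ C ∧
    A.Nonempty ∧ B.Nonempty ∧ D.Nonempty ∧ C \ M = A ∪ B ∪ D ∧
    MutuallySeparated A B ∧ MutuallySeparated A D ∧ MutuallySeparated B D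

/-- A space is atriodic if it contains no subcontinuum which is a triod. -/
def AtriodicSpace (K : Type*) [TopologicalSpace K] : Prop :=
  ∀ C : Set K, IsCompact C → IsConnected C → ¬ IsTriodSet C

/-- A space is indecomposable if it is not the union of two proper subcontinua. -/
def IndecomposableSpace (K : Type*) [TopologicalSpace K] : Prop :=
  ¬ ∃ A B : Set K, IsCompact A ∧ IsConnected A ∧ IsCompact B ∧ IsConnected B ∧
    A ≠ Set.univ ∧ B ≠ Set.univ ∧ A ∪ B = Set.univ

namespace SimpleOd

/-! ### Walks on the vertices of a subdivided simple `m`-od -/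

/-- Two vertices of the subdivided `m`-od (functions `Fin m → ℕ` supported in one leg) are equal
or adjacent. -/
def Near {m : ℕ} (v w : Fin m → ℕ) : Prop :=
  ∃ q a b, v = Pi.single q a ∧ w = Pi.single q b ∧ a ≤ b + 1 ∧ b ≤ a + 1

theorem Near.symm {m : ℕ} {v w : Fin m → ℕ} (h : Near v w) : Near w v := by
  obtain ⟨q, a, b, hv, hw, h1, h2⟩ := h
  exact ⟨q, b, a, hw, hv, h2, h1⟩

theorem Near.apply_le {m : ℕ} {v w : Fin m → ℕ} (h : Near v w) (q : Fin m) :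
    w q ≤ v q + 1 := by
  obtain ⟨p, a, b, rfl, rfl, h1, h2⟩ := h
  rcases eq_or_ne q p with rfl | hq
  · simpa using h2
  · simp [hq]

theorem Near.eq_single {m : ℕ} {v w : Fin m → ℕ} (h : Near v w) {q : Fin m} (hq : 0 < v q) :
    w = Pi.single q (w q) := by
  obtain ⟨p, a, b, rfl, rfl, h1, h2⟩ := h
  rcases eq_or_ne q p with rfl | hqp
  · simp
  · simp [hqp] at hq

theorem Near.eq_single_left {m : ℕ} {v w : Fin m → ℕ} (h : Near v w) {q : Fin m} (hq : 0 < v q) :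
    v = Pi.single q (v q) := by
  obtain ⟨p, a, b, rfl, rfl, h1, h2⟩ := h
  rcases eq_or_ne q p with rfl | hqp
  · simp
  · simp [hqp] at hq

/-- A discrete intermediate value theorem. -/
theorem exists_eq_of_step {D : ℕ → ℕ} {L c : ℕ} (hD : ∀ t < L, D (t + 1) ≤ D t + 1)
    (h0 : D 0 ≤ c) (hL : c ≤ D L) : ∃ t ≤ L, D t = c := by
  induction L with
  | zero => exact ⟨0, le_rfl, le_antisymm h0 hL⟩
  | succ L ih =>
    by_cases h : c ≤ D L
    · obtain ⟨t, ht, rfl⟩ := ih (fun t ht => hD t (by lia)) h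
      exact ⟨t, by lia, rfl⟩
    · have := hD L (by lia)
      exact ⟨L + 1, le_rfl, by lia⟩

/-- An excursion from a vertex stays on one side of it. -/
theorem exists_side {m : ℕ} {w : ℕ → Fin m → ℕ} {L : ℕ}
    (hw : ∀ t < L, Near (w t) (w (t + 1))) (hL : 2 ≤ L)
    (hne : ∀ t, 0 < t → t < L → w t ≠ w 0) :
    ∃ q r, w 0 = Pi.single q r ∧
      ((∀ t, 0 < t → t < L → r < w t q) ∨ (∀ t, 0 < t → t < L → w t q < r)) := by
  obtain ⟨q, a, b, h0, h1, -, -⟩ := hw 0 (by lia)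
  have hab : b ≠ a := by
    rintro rfl
    exact hne 1 (by lia) (by lia) (h1.trans h0.symm)
  refine ⟨q, a, h0, ?_⟩
  rcases lt_or_gt_of_ne hab with hlt | hgt
  · right
    intro t ht
    induction t, ht using Nat.le_induction with
    | base => intro _; rw [h1]; simpa using hlt
    | succ t ht ih =>
      intro htL
      have hn := hw t (by lia)
      have h2 := ih (by lia)
      have h3 := hn.apply_le q
      rcases Nat.lt_or_ge (w (t + 1) q) a with h | h
      · exact h
      · exfalso
        have h4 : w (t + 1) q = a := by lia
        have h5 := hn.symm.eq_single_left (q := q) (by lia)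
        rw [h4, ← h0] at h5
        exact hne (t + 1) (by lia) htL h5
  · left
    intro t ht
    induction t, ht using Nat.le_induction with
    | base => intro _; rw [h1]; simpa using hgt
    | succ t ht ih =>
      intro htL
      have hn := hw t (by lia)
      have h2 := ih (by lia)
      have h3 := hn.symm.apply_le q
      rcases Nat.lt_or_ge a (w (t + 1) q) with h | h
      · exact h
      · exfalso
        have h4 : w (t + 1) q = a := by lia
        have h5 := hn.eq_single (q := q) (by lia)
        rw [h4, ← h0] at h5
        exact hne (t + 1) (by lia) htL h5

/-- A walk that avoids the branch vertex does not leave its leg. -/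
theorem eq_single_of_ne_zero {m : ℕ} {w : ℕ → Fin m → ℕ} {a r : ℕ} {q : Fin m}
    (hw : ∀ t < a, Near (w t) (w (t + 1))) (h0 : w 0 = Pi.single q r)
    (hne : ∀ t, 0 < t → t ≤ a → w t ≠ 0)
    (hside : (∀ t, 0 < t → t ≤ a → r < w t q) ∨ (∀ t, 0 < t → t ≤ a → w t q < r)) :
    ∀ t ≤ a, w t = Pi.single q (w t q) := by
  intro t
  induction t with
  | zero => intro _; rw [h0]; simp
  | succ t ih =>
    intro ht
    have hn := hw t (by lia)
    rcases hside with h | h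
    · exact hn.symm.eq_single_left (by have := h (t + 1) (by lia) ht; lia)
    · rcases Nat.eq_zero_or_pos (w t q) with hz | hp
      · exfalso
        have h1 := ih (by lia)
        rw [hz, Pi.single_zero] at h1
        rcases Nat.eq_zero_or_pos t with rfl | htp
        · rw [h0] at hz
          have := h 1 (by lia) (by lia)
          simp at hz
          lia
        · exact hne t htp (by lia) h1
      · exact hn.eq_single hp

/-- Closed walks over a tree have no holonomy as soon as the transfer along every edge is
compatible with an invariant of the points of the fibres. -/
theorem holonomy {X : Type*} {m : ℕ} {adj : X → X → Prop} {φ : X → Fin m → ℕ} {inv : X → ℤ}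
    (hnear : ∀ x y, adj x y → Near (φ x) (φ y))
    (h0 : ∀ x y, adj x y → φ x = φ y → inv x = inv y)
    (h1 : ∀ x y x' y', adj x y → adj y' x' → φ x = φ x' → φ y = φ y' → inv y = inv y' →
      inv x = inv x') :
    ∀ (L : ℕ) (w : ℕ → X), (∀ t < L, adj (w t) (w (t + 1))) → φ (w 0) = φ (w L) →
      inv (w 0) = inv (w L) := by
  intro L
  induction L using Nat.strong_induction_on with
  | _ L ih =>
    intro w hw hcl
    by_cases hmid : ∃ t, 0 < t ∧ t < L ∧ φ (w t) = φ (w 0)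
    · obtain ⟨t, ht0, htL, ht⟩ := hmid
      have e1 := ih t htL w (fun s hs => hw s (by lia)) ht.symm
      have e2 := ih (L - t) (by lia) (fun s => w (t + s))
        (fun s hs => hw (t + s) (by lia))
        (by simp only [add_zero]; rw [show t + (L - t) = L by lia, ht, hcl])
      simp only [add_zero] at e2
      rw [show t + (L - t) = L by lia] at e2
      exact e1.trans e2
    · push Not at hmid
      rcases Nat.lt_or_ge L 2 with hL | hL
      · interval_cases L
        · rfl
        · exact h0 _ _ (hw 0 (by lia)) hcl
      · have key : φ (w 1) = φ (w (L - 1)) := by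
          obtain ⟨q, r, e, hs⟩ := exists_side (w := fun t => φ (w t))
            (fun t ht => hnear _ _ (hw t ht)) hL hmid
          have n1 : Near (φ (w 0)) (φ (w 1)) := hnear _ _ (hw 0 (by lia))
          have n2 : Near (φ (w 0)) (φ (w (L - 1))) := by
            have := hnear _ _ (hw (L - 1) (by lia))
            rw [show L - 1 + 1 = L by lia, ← hcl] at this
            exact this.symm
          have f : ∀ v, Near (φ (w 0)) v → ((r < v q → v = Pi.single q (r + 1)) ∧
              (v q < r → v = Pi.single q (r - 1))) := by
            intro v hv
            have a1 := hv.apply_le q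
            have a2 := hv.symm.apply_le q
            simp only [e, Pi.single_eq_same] at a1 a2
            refine ⟨fun h => ?_, fun h => ?_⟩
            · have := hv.symm.eq_single_left (q := q) (by lia)
              rwa [show v q = r + 1 by lia] at this
            · have := hv.eq_single (q := q) (by simp only [e, Pi.single_eq_same]; lia)
              rwa [show v q = r - 1 by lia] at this
          rcases hs with hs | hs
          · exact ((f _ n1).1 (hs 1 (by lia) (by lia))).trans
              ((f _ n2).1 (hs (L - 1) (by lia) (by lia))).symm
          · exact ((f _ n1).2 (hs 1 (by lia) (by lia))).trans
              ((f _ n2).2 (hs (L - 1) (by lia) (by lia))).symm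
        have e1 := ih (L - 2) (by lia) (fun s => w (s + 1))
          (fun s hs => hw (s + 1) (by lia))
          (by simp only [zero_add]; rw [show L - 2 + 1 = L - 1 by lia, key])
        simp only [zero_add] at e1
        rw [show L - 2 + 1 = L - 1 by lia] at e1
        refine h1 _ _ _ _ (hw 0 (by lia)) ?_ hcl key e1
        have := hw (L - 1) (by lia)
        rwa [show L - 1 + 1 = L by lia] at this

/-- Every finite chain for a relation is the initial segment of a sequence. -/
theorem exists_walk {X : Type*} {adj : X → X → Prop} {x y : X}
    (h : Relation.ReflTransGen adj x y) :
    ∃ (L : ℕ) (w : ℕ → X), (∀ t < L, adj (w t) (w (t + 1))) ∧ w 0 = x ∧ w L = y := by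
  induction h with
  | refl => exact ⟨0, fun _ => x, by simp, rfl, rfl⟩
  | @tail b c _ hbc ih =>
    obtain ⟨L, w, hw, h0, hL⟩ := ih
    refine ⟨L + 1, fun t => if t ≤ L then w t else c, fun t ht => ?_, by simpa using h0, by simp⟩
    rcases Nat.lt_or_ge t L with h | h
    · simpa [h.le, Nat.succ_le_of_lt h] using hw t h
    · obtain rfl : t = L := by lia
      simpa [hL] using hbc

/-! ### Missing letters -/

theorem exists_ray_letter {n : ℕ} (hn : 3 ≤ n) (lab : ℕ → Option (Fin n)) :
    ∃ up : Option (Fin n), ∀ j₀ : Fin n, up ≠ some j₀ → ∃ J : ℕ → Fin n, J 0 = j₀ ∧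
      ∀ r, (lab r = none → lab (r + 1) = none → J r = J (r + 1)) ∧
        (∀ k, lab r = none → lab (r + 1) = some k → J r ≠ k) ∧
        (∀ k, lab (r + 1) = none → lab r = some k → J (r + 1) ≠ k) := by
  classical
  have hup : ∃ up : ℕ → Option (Fin n), (∀ r, lab r = none → up r = up (r + 1)) ∧
      ∀ r k, lab r = some k → up r = some k := by
    refine ⟨fun r => if h : ∃ d, lab (r + d) ≠ none then lab (r + Nat.find h) else none, ?_, ?_⟩
    · intro r hr
      by_cases h : ∃ d, lab (r + 1 + d) ≠ none
      · have h' : ∃ d, lab (r + d) ≠ none := by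
          obtain ⟨d, hd⟩ := h
          exact ⟨d + 1, by rwa [show r + (d + 1) = r + 1 + d by lia]⟩
        have : Nat.find h' = Nat.find h + 1 := by
          rw [Nat.find_eq_iff]
          refine ⟨?_, ?_⟩
          · have := Nat.find_spec h
            rwa [show r + (Nat.find h + 1) = r + 1 + Nat.find h by lia]
          · intro d hd
            rcases d with _ | d
            · simpa using hr
            · have := Nat.find_min h (m := d) (by lia)
              rwa [show r + (d + 1) = r + 1 + d by lia]
        simp only [h, h', dif_pos, this]
        congr 1
        lia
      · have h' : ¬ ∃ d, lab (r + d) ≠ none := by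
          rintro ⟨d, hd⟩
          rcases d with _ | d
          · exact hd (by simpa using hr)
          · exact h ⟨d, by rwa [show r + 1 + d = r + (d + 1) by lia]⟩
        simp only [h, h', dif_neg, not_false_eq_true]
    · intro r k hr
      have h : ∃ d, lab (r + d) ≠ none := ⟨0, by simp [hr]⟩
      have : Nat.find h = 0 := by
        rw [Nat.find_eq_zero]; simp [hr]
      simp [h, this, hr]
  obtain ⟨up, hup0, hup1⟩ := hup
  refine ⟨up 0, fun j₀ hj₀ => ?_⟩
  have pick : ∀ a b : Option (Fin n), ∃ j : Fin n, a ≠ some j ∧ b ≠ some j := by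
    intro a b
    by_contra! hcon
    have hsub : (Finset.univ : Finset (Fin n)).image some ⊆ {a, b} := by
      intro o ho
      obtain ⟨j, -, rfl⟩ := Finset.mem_image.1 ho
      by_cases h : a = some j
      · simp [h]
      · simp [hcon j h]
    have h2 := Finset.card_le_card hsub
    rw [Finset.card_image_of_injective _ (Option.some_injective _)] at h2
    have h3 := Finset.card_le_two (a := a) (b := b)
    simp at h2
    lia
  choose pk hpk using pick
  let J : ℕ → Fin n := fun r => Nat.rec j₀
    (fun r j => if lab r = none then j else pk (lab r) (up (r + 1))) r
  have hJ : ∀ r, J (r + 1) = if lab r = none then J r else pk (lab r) (up (r + 1)) :=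
    fun r => rfl
  have hinv : ∀ r, lab r = none → up r ≠ some (J r) := by
    intro r
    induction r with
    | zero => intro _; exact hj₀
    | succ r ih =>
      intro _
      rw [hJ]
      split_ifs with h
      · rw [← hup0 r h]; exact ih h
      · exact (hpk _ _).2
  refine ⟨J, rfl, fun r => ⟨fun h _ => ?_, fun k h h' => ?_, fun k h h' => ?_⟩⟩
  · rw [hJ, if_pos h]
  · rintro rfl
    exact hinv r h ((hup0 r h).trans (hup1 _ _ h'))
  · intro hk
    rw [hJ, if_neg (by rw [h']; simp)] at hk
    exact (hpk _ _).1 (h'.trans (congrArg some hk.symm))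

/-- If the vertices of the subdivided `m`-od are partially labelled by `n > m` letters, `n ≥ 3`,
then every region of unlabelled vertices misses one of the letters around it. -/
theorem exists_missing_letter {n m : ℕ} (hn : 3 ≤ n) (hm : m < n)
    (lab : (Fin m → ℕ) → Option (Fin n)) :
    ∃ J : (Fin m → ℕ) → Fin n, ∀ v w, Near v w → lab v = none →
      (lab w = none → J v = J w) ∧ (∀ k, lab w = some k → J v ≠ k) := by
  classical
  choose up hup using fun q : Fin m => exists_ray_letter hn (fun r => lab (Pi.single q r))
  obtain ⟨j₀, hj₀⟩ : ∃ j₀ : Fin n, ∀ q, up q ≠ some j₀ := by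
    by_contra! hcon
    choose q hq using hcon
    have : Function.Injective q := by
      intro a b hab
      have := (hq a).symm.trans (hab ▸ hq b)
      simpa using this
    have := Fintype.card_le_of_injective q this
    simp at this
    lia
  choose J hJ0 hJ using fun q => hup q j₀ (hj₀ q)
  let K : (Fin m → ℕ) → Fin n := fun v =>
    if h : ∃ q, v q ≠ 0 then J h.choose (v h.choose) else j₀
  have hK : ∀ q r, K (Pi.single q r) = J q r := by
    intro q r
    rcases Nat.eq_zero_or_pos r with rfl | hr
    · simp [K, hJ0]
    · have h : ∃ p, (Pi.single q r : Fin m → ℕ) p ≠ 0 := ⟨q, by simp; lia⟩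
      have hc : h.choose = q := by
        by_contra hne
        exact h.choose_spec (by simp [hne])
      simp only [K, h, dif_pos]
      rw [hc]
      simp
  refine ⟨K, ?_⟩
  rintro v w ⟨q, a, b, rfl, rfl, h1, h2⟩ hv
  rw [hK, hK]
  rcases lt_trichotomy a b with h | rfl | h
  · obtain rfl : b = a + 1 := by lia
    exact ⟨(hJ q a).1 hv, fun k => (hJ q a).2.1 k hv⟩
  · exact ⟨fun _ => rfl, fun k hk => by simp [hv] at hk⟩
  · obtain rfl : a = b + 1 := by lia
    exact ⟨fun h => ((hJ q b).1 h hv).symm, fun k hk => (hJ q b).2.2 k hv hk⟩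

/-! ### Factoring one level down -/

/-- The tent of height one over `[-1/2, 1/2]`. -/
noncomputable def bump (t : ℝ) : ℝ := max 0 (1 - 2 * |t|)

/-- The height of the `s`-th tent on the `i`-th leg. -/
noncomputable def height {n : ℕ} (i : Fin n) (s : ℕ) : ℝ :=
  if s = i + 1 ∨ s = 5 * n + i then 1 / 2 else 1

theorem bump_nonneg (t : ℝ) : 0 ≤ bump t := le_max_left _ _

theorem bump_le_one (t : ℝ) : bump t ≤ 1 := max_le zero_le_one (by have := abs_nonneg t; linarith)

theorem bump_of_abs_le {t : ℝ} (h : |t| ≤ 1 / 2) : bump t = 1 - 2 * |t| :=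
  max_eq_right (by linarith)

theorem height_eq_half_or {n : ℕ} (i : Fin n) (s : ℕ) : height i s = 1 / 2 ∨ height i s = 1 := by
  unfold height; split_ifs <;> simp

theorem half_le_height {n : ℕ} (i : Fin n) (s : ℕ) : 1 / 2 ≤ height i s := by
  rcases height_eq_half_or i s with h | h <;> norm_num [h]

theorem height_le_one {n : ℕ} (i : Fin n) (s : ℕ) : height i s ≤ 1 := by
  rcases height_eq_half_or i s with h | h <;> norm_num [h]

theorem height_first {n : ℕ} {i j : Fin n} : height i (j + 1) = 1 ↔ i ≠ j := by
  unfold height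
  have := i.2
  have := j.2
  split_ifs with h
  · rcases h with h | h
    · norm_num [Fin.ext_iff]; lia
    · lia
  · simp only [true_iff]
    rintro rfl
    exact h (Or.inl rfl)

theorem height_second {n : ℕ} {i j : Fin n} : height i (5 * n + j) = 1 ↔ i ≠ j := by
  unfold height
  have := i.2
  have := j.2
  split_ifs with h
  · rcases h with h | h
    · lia
    · norm_num [Fin.ext_iff]; lia
  · simp only [true_iff]
    rintro rfl
    exact h (Or.inr rfl)

/-- A discretised factorisation of a bonding map `F` through a subdivided `m`-od: the point `x`
lies in the leg `leg x` at height `u x`, measured in units of one letter, and is sent to the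
vertex `φ x`. -/
structure Factorization (n m : ℕ) [NeZero n] (X : Type*) where
  adj : X → X → Prop
  φ : X → Fin m → ℕ
  u : X → ℝ
  leg : X → Fin n
  F : X → Fin n → ℝ
  symm : ∀ x y, adj x y → adj y x
  near : ∀ x y, adj x y → Near (φ x) (φ y)
  conn : ∀ x y, Relation.ReflTransGen adj x y
  u_nonneg : ∀ x, 0 ≤ u x
  u_step : ∀ x y, adj x y → |u x - u y| ≤ 1 / 16
  leg_step : ∀ x y, adj x y → leg x = leg y ∨ u x ≤ 1 / 16
  F_eq : ∀ (x : X) (s : ℕ), |u x - s| ≤ 1 / 2 →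
    F x = Pi.single (Fin.ofNat n s) (height (leg x) s * bump (u x - s))
  F_close : ∀ x y, φ x = φ y → dist (F x) (F y) ≤ 1 / 16

namespace Factorization

variable {n m : ℕ} [NeZero n] {X : Type*} (S : Factorization n m X)

/-- The letter nearest to `x`. -/
noncomputable def pos (x : X) : ℕ := ⌊S.u x + 1 / 2⌋₊

/-- The size of the image of `x`. -/
noncomputable def amp (x : X) : ℝ := height (S.leg x) (S.pos x) * bump (S.u x - S.pos x)

theorem abs_sub_pos_le (x : X) : |S.u x - S.pos x| ≤ 1 / 2 := by
  have h0 := S.u_nonneg x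
  have h1 := Nat.floor_le (show 0 ≤ S.u x + 1 / 2 by linarith)
  have h2 := Nat.lt_floor_add_one (S.u x + 1 / 2)
  rw [abs_le]
  constructor <;> unfold pos <;> linarith

theorem pos_eq_of_lt {x : X} {s : ℕ} (h : |S.u x - s| < 1 / 2) : S.pos x = s := by
  rw [abs_lt] at h
  unfold pos
  rw [Nat.floor_eq_iff (by linarith [S.u_nonneg x])]
  constructor <;> linarith

theorem F_eq_amp (x : X) : S.F x = Pi.single (Fin.ofNat n (S.pos x)) (S.amp x) :=
  S.F_eq x _ (S.abs_sub_pos_le x)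

theorem amp_le_bump (x : X) : S.amp x ≤ bump (S.u x - S.pos x) :=
  mul_le_of_le_one_left (bump_nonneg _) (height_le_one _ _)

theorem half_bump_le_amp (x : X) : 1 / 2 * bump (S.u x - S.pos x) ≤ S.amp x :=
  mul_le_mul_of_nonneg_right (half_le_height _ _) (bump_nonneg _)

open Classical in
/-- The letter, if any, that is visible at a vertex of the `m`-od. -/
noncomputable def lab (v : Fin m → ℕ) : Option (Fin n) :=
  if h : ∃ z, S.φ z = v ∧ 1 / 4 < S.amp z then some (Fin.ofNat n (S.pos h.choose)) else none

theorem of_lab_eq_some {x : X} {k : Fin n} (h : S.lab (S.φ x) = some k) :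
    Fin.ofNat n (S.pos x) = k ∧ |S.u x - S.pos x| ≤ 13 / 32 := by
  unfold lab at h
  split_ifs at h with hz
  obtain ⟨h1, h2⟩ := hz.choose_spec
  set z := hz.choose
  simp only [Option.some.injEq] at h
  have h3 := (dist_le_pi_dist (S.F x) (S.F z) k).trans (S.F_close x z h1.symm)
  rw [S.F_eq_amp x, S.F_eq_amp z, h, Pi.single_eq_same, Real.dist_eq, abs_le] at h3
  have hk : Fin.ofNat n (S.pos x) = k := by
    by_contra hne
    rw [Pi.single_eq_of_ne (Ne.symm hne)] at h3
    linarith [h3.1]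
  refine ⟨hk, ?_⟩
  rw [hk, Pi.single_eq_same] at h3
  have h4 := S.amp_le_bump x
  rw [bump_of_abs_le (S.abs_sub_pos_le x)] at h4
  linarith [h3.1]

theorem amp_le_of_lab_eq_none {x : X} (h : S.lab (S.φ x) = none) : S.amp x ≤ 1 / 4 := by
  by_contra! hx
  unfold lab at h
  rw [dif_pos ⟨x, rfl, hx⟩] at h
  simp at h

theorem of_lab_eq_none {x : X} (h : S.lab (S.φ x) = none) : 1 / 4 ≤ |S.u x - S.pos x| := by
  have h1 := S.amp_le_of_lab_eq_none h
  have h2 := S.half_bump_le_amp x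
  rw [bump_of_abs_le (S.abs_sub_pos_le x)] at h2
  linarith

theorem pos_eq_of_adj {x y : X} (h : S.adj x y) {k l : Fin n} (hx : S.lab (S.φ x) = some k)
    (hy : S.lab (S.φ y) = some l) : S.pos x = S.pos y := by
  have h1 := (S.of_lab_eq_some hx).2
  have h2 := (S.of_lab_eq_some hy).2
  have h3 := S.u_step x y h
  rw [abs_le] at h1 h2 h3
  have e1 : (S.pos x : ℝ) < S.pos y + 1 := by linarith
  have e2 : (S.pos y : ℝ) < S.pos x + 1 := by linarith
  norm_cast at e1 e2
  lia

theorem floor_eq_of_adj {x y : X} (h : S.adj x y) (hx : S.lab (S.φ x) = none) :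
    ⌊S.u x⌋ = ⌊S.u y⌋ := by
  have h1 := S.of_lab_eq_none hx
  have h2 := S.abs_sub_pos_le x
  have h3 := S.u_step x y h
  rw [abs_le] at h2 h3
  rcases le_abs.1 h1 with h1 | h1
  · rw [(Int.floor_eq_iff (z := (S.pos x : ℤ))).2, (Int.floor_eq_iff (z := (S.pos x : ℤ))).2] <;>
      constructor <;> push_cast <;> linarith
  · rw [(Int.floor_eq_iff (z := (S.pos x : ℤ) - 1)).2,
      (Int.floor_eq_iff (z := (S.pos x : ℤ) - 1)).2] <;>
      constructor <;> push_cast <;> linarith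

theorem ofNat_eq_iff_mod {s : ℕ} {k : Fin n} : Fin.ofNat n s = k ↔ s % n = k := by
  rw [Fin.ext_iff]; simp [Fin.ofNat]

theorem ediv_floor_of_adj {x y : X} (h : S.adj x y) {k j : Fin n}
    (hy : S.lab (S.φ y) = some k) (hj : j ≠ k) :
    (⌊S.u x⌋ - (j : ℤ)) / n = ((S.pos y : ℤ) - (j : ℤ)) / n := by
  obtain ⟨h1, h2⟩ := S.of_lab_eq_some hy
  have h3 := S.u_step x y h
  rw [abs_le] at h2 h3
  have e1 : ⌊S.u x⌋ < (S.pos y : ℤ) + 1 := by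
    rw [Int.floor_lt]; push_cast; linarith
  have e2 : (S.pos y : ℤ) - 1 ≤ ⌊S.u x⌋ := by
    rw [Int.le_floor]; push_cast; linarith
  rcases (show ⌊S.u x⌋ = (S.pos y : ℤ) ∨ ⌊S.u x⌋ = (S.pos y : ℤ) - 1 by lia) with e | e
  · rw [e]
  · rw [e]
    rw [ofNat_eq_iff_mod] at h1
    have hn : (0 : ℤ) < n := by exact_mod_cast Nat.pos_of_ne_zero (NeZero.ne n)
    have h4 : ¬ (n : ℤ) ∣ (S.pos y : ℤ) - j := by
      intro hd
      apply hj
      have h5 : (S.pos y : ℤ) % n = (j : ℤ) % n :=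
        Int.emod_eq_emod_iff_emod_sub_eq_zero.2 (Int.emod_eq_zero_of_dvd hd)
      have h6 : S.pos y % n = (j : ℕ) % n := by exact_mod_cast h5
      rw [h1, Nat.mod_eq_of_lt j.2] at h6
      exact Fin.ext h6.symm
    set z := (S.pos y : ℤ) - j with hz
    rw [show (S.pos y : ℤ) - 1 - j = z - 1 by lia]
    have h7 : z % n ≠ 0 := fun h => h4 (Int.dvd_of_emod_eq_zero h)
    have h8 := Int.emod_nonneg z hn.ne'
    have h9 := Int.emod_lt_of_pos z hn
    have h10 := Int.mul_ediv_add_emod z n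
    rw [mul_comm] at h10
    rw [Int.ediv_eq_iff_of_pos hn]
    constructor <;> lia

theorem exists_inv (hn : 3 ≤ n) (hm : m < n) : ∃ J : (Fin m → ℕ) → Fin n, ∀ x y, S.φ x = S.φ y →
    (S.lab (S.φ x) = none → (⌊S.u x⌋ - ((J (S.φ x) : ℕ) : ℤ)) / n =
      (⌊S.u y⌋ - ((J (S.φ x) : ℕ) : ℤ)) / n) ∧
    (S.lab (S.φ x) ≠ none → S.pos x = S.pos y) := by
  obtain ⟨J, hJ⟩ := exists_missing_letter hn hm S.lab
  refine ⟨J, fun x y hxy => ?_⟩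
  have hn0 : (0 : ℤ) < n := by lia
  classical
  let inv : X → ℤ := fun x => if S.lab (S.φ x) = none then (⌊S.u x⌋ - ((J (S.φ x) : ℕ) : ℤ)) / n
    else S.pos x
  have inv_none : ∀ x, S.lab (S.φ x) = none → inv x = (⌊S.u x⌋ - ((J (S.φ x) : ℕ) : ℤ)) / n :=
    fun x hx => if_pos hx
  have inv_some : ∀ x k, S.lab (S.φ x) = some k → inv x = S.pos x :=
    fun x k hx => if_neg (by simp [hx])
  have nn : ∀ x y, S.adj x y → S.lab (S.φ x) = none → S.lab (S.φ y) = none → inv x = inv y := by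
    intro x y h hx hy
    rw [inv_none x hx, inv_none y hy, S.floor_eq_of_adj h hx,
      (hJ _ _ (S.near _ _ h) hx).1 hy]
  have ss : ∀ x y k l, S.adj x y → S.lab (S.φ x) = some k → S.lab (S.φ y) = some l →
      inv x = inv y := by
    intro x y k l h hx hy
    rw [inv_some x k hx, inv_some y l hy, S.pos_eq_of_adj h hx hy]
  have ns : ∀ x y k, S.adj x y → S.lab (S.φ x) = none → S.lab (S.φ y) = some k →
      inv x = (inv y - ((J (S.φ x) : ℕ) : ℤ)) / n := by
    intro x y k h hx hy
    rw [inv_none x hx, inv_some y k hy]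
    exact S.ediv_floor_of_adj h hy ((hJ _ _ (S.near _ _ h) hx).2 k hy)
  have key : inv x = inv y := by
    obtain ⟨L, w, hw, h0, hL⟩ := exists_walk (S.conn x y)
    rw [← h0, ← hL]
    refine holonomy (adj := S.adj) (φ := S.φ) S.near ?_ ?_ L w hw (by rw [h0, hL, hxy])
    · intro x y h hφ
      rcases hx : S.lab (S.φ x) with _ | k
      · exact nn x y h hx (hφ ▸ hx)
      · exact ss x y k k h hx (hφ ▸ hx)
    · intro x y x' y' h h' hx hy hinv
      rcases ex : S.lab (S.φ x) with _ | k <;> rcases ey : S.lab (S.φ y) with _ | l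
      · exact (nn x y h ex ey).trans (hinv.trans (nn y' x' h' (hy ▸ ey) (hx ▸ ex)))
      · rw [ns x y l h ex ey, ns x' y' l (S.symm _ _ h') (hx ▸ ex) (hy ▸ ey), hinv, hx]
      · have e1 := ns y x k (S.symm _ _ h) ey ex
        have e2 := ns y' x' k h' (hy ▸ ey) (hx ▸ ex)
        rw [← hinv, e1, ← hy] at e2
        rw [inv_some x k ex, inv_some x' k (hx ▸ ex)] at e2 ⊢
        have m1 := ofNat_eq_iff_mod.1 (S.of_lab_eq_some ex).1
        have m2 := ofNat_eq_iff_mod.1 (S.of_lab_eq_some (x := x') (hx ▸ ex)).1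
        set j : ℤ := ((J (S.φ y) : ℕ) : ℤ)
        have m3 : (S.pos x : ℤ) % n = (S.pos x' : ℤ) % n := by exact_mod_cast m1.trans m2.symm
        have m4 : ((S.pos x : ℤ) - j) % n = ((S.pos x' : ℤ) - j) % n := by
          rw [Int.sub_emod, m3, ← Int.sub_emod]
        have m5 := Int.mul_ediv_add_emod ((S.pos x : ℤ) - j) n
        have m6 := Int.mul_ediv_add_emod ((S.pos x' : ℤ) - j) n
        rw [e2, m4, m6] at m5
        lia
      · exact (ss x y k l h ex ey).trans (hinv.trans (ss y' x' l k h' (hy ▸ ey) (hx ▸ ex)))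
  constructor
  · intro h
    rw [inv_none x h, inv_none y (hxy ▸ h), ← hxy] at key
    exact key
  · intro h
    obtain ⟨k, hk⟩ := Option.ne_none_iff_exists'.1 h
    rw [inv_some x k hk, inv_some y k (hxy ▸ hk)] at key
    exact_mod_cast key

theorem pos_eq (hn : 3 ≤ n) (hm : m < n) {x y : X} (h : S.φ x = S.φ y)
    (hx : S.lab (S.φ x) ≠ none) : S.pos x = S.pos y :=
  ((S.exists_inv hn hm).choose_spec x y h).2 hx

theorem u_close (hn : 3 ≤ n) (hm : m < n) {x y : X} (h : S.φ x = S.φ y) :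
    |S.u x - S.u y| < n := by
  have hn3 : (3 : ℝ) ≤ n := by exact_mod_cast hn
  rcases hx : S.lab (S.φ x) with _ | k
  · have h1 := ((S.exists_inv hn hm).choose_spec x y h).1 hx
    set j : ℤ := (((S.exists_inv hn hm).choose (S.φ x) : ℕ) : ℤ)
    have hn0 : (0 : ℤ) < n := by lia
    have m1 := Int.mul_ediv_add_emod (⌊S.u x⌋ - j) n
    have m2 := Int.mul_ediv_add_emod (⌊S.u y⌋ - j) n
    have m3 := Int.emod_nonneg (⌊S.u x⌋ - j) hn0.ne'
    have m4 := Int.emod_lt_of_pos (⌊S.u x⌋ - j) hn0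
    have m5 := Int.emod_nonneg (⌊S.u y⌋ - j) hn0.ne'
    have m6 := Int.emod_lt_of_pos (⌊S.u y⌋ - j) hn0
    rw [h1] at m1
    have e1 : ⌊S.u x⌋ + 1 ≤ ⌊S.u y⌋ + n := by lia
    have e2 : ⌊S.u y⌋ + 1 ≤ ⌊S.u x⌋ + n := by lia
    have r1 : (⌊S.u x⌋ : ℝ) + 1 ≤ ⌊S.u y⌋ + n := by exact_mod_cast e1
    have r2 : (⌊S.u y⌋ : ℝ) + 1 ≤ ⌊S.u x⌋ + n := by exact_mod_cast e2
    rw [abs_lt]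
    constructor <;>
      linarith [Int.floor_le (S.u x), Int.floor_le (S.u y), Int.lt_floor_add_one (S.u x),
        Int.lt_floor_add_one (S.u y)]
  · have h1 := S.pos_eq hn hm h (by simp [hx])
    have h2 := (S.of_lab_eq_some hx).2
    have h3 := (S.of_lab_eq_some (h ▸ hx)).2
    rw [h1] at h2
    rw [abs_le] at h2 h3
    rw [abs_lt]
    constructor <;> linarith

end Factorization

namespace Factorization

variable {n m : ℕ} [NeZero n] {X : Type*} (S : Factorization n m X)

/-- The letter `s` is visible at the fibre of `x`, which lies close to it. -/
def At (x : X) (s : ℕ) : Prop := S.lab (S.φ x) ≠ none ∧ S.pos x = s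

theorem At.abs_le {S : Factorization n m X} {x : X} {s : ℕ} (h : S.At x s) :
    |S.u x - s| ≤ 13 / 32 := by
  obtain ⟨h1, rfl⟩ := h
  obtain ⟨k, hk⟩ := Option.ne_none_iff_exists'.1 h1
  exact (S.of_lab_eq_some hk).2

theorem amp_of_abs_le {x : X} {s : ℕ} (h : |S.u x - s| ≤ 1 / 16) :
    S.pos x = s ∧ 7 / 8 * height (S.leg x) s ≤ S.amp x := by
  have h1 : S.pos x = s := S.pos_eq_of_lt (by linarith)
  refine ⟨h1, ?_⟩
  unfold amp
  rw [h1, bump_of_abs_le (by linarith)]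
  nlinarith [half_le_height (S.leg x) s]

theorem at_of_abs_le {x : X} {s : ℕ} (h : |S.u x - s| ≤ 1 / 16) : S.At x s := by
  obtain ⟨h1, h2⟩ := S.amp_of_abs_le h
  refine ⟨fun h3 => ?_, h1⟩
  have := S.amp_le_of_lab_eq_none h3
  linarith [half_le_height (S.leg x) s]

theorem At.congr {S : Factorization n m X} (hn : 3 ≤ n) (hm : m < n) {x y : X} {s : ℕ}
    (hx : S.At x s) (h : S.φ x = S.φ y) : S.At y s :=
  ⟨h ▸ hx.1, (S.pos_eq hn hm h hx.1).symm.trans hx.2⟩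

theorem height_eq_one (hn : 3 ≤ n) (hm : m < n) {x y : X} {s : ℕ} (h : S.φ x = S.φ y)
    (hs : |S.u x - s| ≤ 1 / 16) (h1 : height (S.leg x) s = 1) : height (S.leg y) s = 1 := by
  by_contra h2
  have h2 := (height_eq_half_or (S.leg y) s).resolve_right h2
  obtain ⟨p1, a1⟩ := S.amp_of_abs_le hs
  have p2 := ((S.at_of_abs_le hs).congr hn hm h).2
  have h3 := (dist_le_pi_dist (S.F x) (S.F y) (Fin.ofNat n s)).trans (S.F_close x y h)
  rw [S.F_eq_amp x, S.F_eq_amp y, p1, p2, Pi.single_eq_same, Pi.single_eq_same, Real.dist_eq,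
    _root_.abs_le] at h3
  have a2 : S.amp y ≤ 1 / 2 := by
    unfold amp
    rw [p2, h2]
    linarith [bump_le_one (S.u y - s)]
  rw [h1] at a1
  linarith [h3.2]

theorem exists_near_of_walk {w : ℕ → X} {L s : ℕ} (hw : ∀ t < L, S.adj (w t) (w (t + 1)))
    (h0 : s ≤ S.u (w 0)) (hL : S.u (w L) ≤ s) : ∃ t ≤ L, |S.u (w t) - s| ≤ 1 / 16 := by
  classical
  have h : ∃ t, S.u (w t) ≤ s := ⟨L, hL⟩
  have hle : Nat.find h ≤ L := Nat.find_min' h hL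
  refine ⟨Nat.find h, hle, ?_⟩
  have h1 := Nat.find_spec h
  rcases e : Nat.find h with _ | t
  · rw [e] at h1
    rw [abs_le]; constructor <;> linarith
  · rw [e] at h1 hle
    have h2 := Nat.find_min h (m := t) (by lia)
    push Not at h2
    have h3 := S.u_step _ _ (hw t (by lia))
    rw [abs_le] at h3 ⊢
    constructor <;> linarith [h3.2]

theorem exists_at_of_walk {w : ℕ → X} {L s : ℕ} (hw : ∀ t < L, S.adj (w t) (w (t + 1)))
    (h0 : s ≤ S.u (w 0)) (hL : S.u (w L) ≤ s + 1 / 16) : ∃ t ≤ L, S.At (w t) s := by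
  rcases le_or_gt (S.u (w L)) s with h | h
  · obtain ⟨t, ht, hs⟩ := S.exists_near_of_walk hw h0 h
    exact ⟨t, ht, S.at_of_abs_le hs⟩
  · refine ⟨L, le_rfl, S.at_of_abs_le ?_⟩
    rw [abs_le]; constructor <;> linarith

/-- A walk inside the leg `i` that ends with its first visit to the letter `s`. -/
structure Descent (s : ℕ) (i : Fin n) (w : ℕ → X) (a : ℕ) : Prop where
  walk : ∀ t < a, S.adj (w t) (w (t + 1))
  leg_eq : ∀ t ≤ a, S.leg (w t) = i
  at_end : S.At (w a) s
  not_at : ∀ t < a, ¬ S.At (w t) s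

theorem Descent.le_u {S : Factorization n m X} {s : ℕ} {i : Fin n} {w : ℕ → X} {a : ℕ}
    (h : S.Descent s i w a) (h0 : s ≤ S.u (w 0)) {t : ℕ} (ht : t ≤ a) :
    (s : ℝ) - 1 / 2 ≤ S.u (w t) := by
  rcases ht.lt_or_eq with ht | rfl
  · by_contra! hlt
    obtain ⟨t', ht', hat⟩ := S.exists_at_of_walk (L := t) (fun r hr => h.walk r (by lia)) h0
      (by linarith)
    exact h.not_at t' (by lia) hat
  · have := h.at_end.abs_le
    rw [_root_.abs_le] at this
    linarith [this.1]

theorem exists_descent {w : ℕ → X} {L s : ℕ} (hw : ∀ t < L, S.adj (w t) (w (t + 1)))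
    (h0 : s ≤ S.u (w 0)) (hleg : S.leg (w 0) ≠ S.leg (w L)) :
    ∃ a ≤ L, S.Descent s (S.leg (w 0)) w a := by
  classical
  have hlow : ∃ t ≤ L, S.u (w t) ≤ 1 / 16 := by
    by_contra! hcon
    have : ∀ t ≤ L, S.leg (w t) = S.leg (w 0) := by
      intro t
      induction t with
      | zero => intro _; rfl
      | succ t ih =>
        intro ht
        rcases S.leg_step _ _ (hw t (by lia)) with h | h
        · rw [← h, ih (by lia)]
        · exact absurd h (not_le.2 (hcon t (by lia)))
    exact hleg (this L le_rfl).symm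
  have hs0 : (0 : ℝ) ≤ s := Nat.cast_nonneg s
  have hat : ∀ t ≤ L, S.u (w t) ≤ 1 / 16 → ∃ t' ≤ t, S.At (w t') s := fun t ht hu =>
    S.exists_at_of_walk (fun r hr => hw r (by lia)) h0 (by linarith)
  obtain ⟨t₀, ht₀, hu₀⟩ := hlow
  obtain ⟨t₁, ht₁, hA⟩ := hat t₀ ht₀ hu₀
  have hex : ∃ t, S.At (w t) s := ⟨t₁, hA⟩
  have hle : Nat.find hex ≤ t₁ := Nat.find_min' hex hA
  refine ⟨Nat.find hex, by lia, fun t ht => hw t (by lia), ?_, Nat.find_spec hex,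
    fun t ht => Nat.find_min hex ht⟩
  intro t
  induction t with
  | zero => intro _; rfl
  | succ t ih =>
    intro ht
    rcases S.leg_step _ _ (hw t (by lia)) with h | h
    · rw [← h, ih (by lia)]
    · obtain ⟨t', ht', hA'⟩ := hat t (by lia) h
      exact absurd hA' (Nat.find_min hex (by lia))

/-- Two descents in different legs cannot cover the same segment of the `m`-od. -/
theorem Descent.false_of_depth {S : Factorization n m X} (hn : 3 ≤ n) (hm : m < n) {s s' : ℕ}
    {i j : Fin n} {v w : ℕ → X} {a b : ℕ} (hv : S.Descent s i v a) (hw : S.Descent s j w b)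
    {D E : ℕ → ℕ} (hD0 : D 0 = 0) (hE0 : E 0 = 0) (hD : ∀ t < a, D (t + 1) ≤ D t + 1)
    (hE : ∀ t < b, E (t + 1) ≤ E t + 1)
    (heq : ∀ t ≤ a, ∀ r ≤ b, D t = E r → S.φ (v t) = S.φ (w r)) (hs : s < s')
    (hi : height i s' = 1) (hj : height j s' ≠ 1) (h0 : s' ≤ S.u (v 0)) : False := by
  have hab : D a = E b := by
    rcases le_total (D a) (E b) with h | h
    · obtain ⟨t, ht, e⟩ := exists_eq_of_step hE (by lia) h
      have := hv.at_end.congr hn hm (heq a le_rfl t ht e.symm)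
      rcases ht.lt_or_eq with ht | rfl
      · exact absurd this (hw.not_at t ht)
      · exact e.symm
    · obtain ⟨t, ht, e⟩ := exists_eq_of_step hD (by lia) h
      have := hw.at_end.congr hn hm (heq t ht b le_rfl e).symm
      rcases ht.lt_or_eq with ht | rfl
      · exact absurd this (hv.not_at t ht)
      · exact e
  have hlt : ∀ t < a, D t < D a := by
    intro t ht
    by_contra! hle
    obtain ⟨r, hr, e⟩ := exists_eq_of_step (D := D) (L := t) (fun q hq => hD q (by lia))
      (by lia) hle
    have := hw.at_end.congr hn hm (heq r (by lia) b le_rfl (e.trans hab)).symm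
    exact hv.not_at r (by lia) this
  have hend := hv.at_end.abs_le
  rw [_root_.abs_le] at hend
  have hss : (s : ℝ) + 1 ≤ s' := by exact_mod_cast hs
  obtain ⟨t, ht, hts⟩ := S.exists_near_of_walk hv.walk h0 (by linarith [hend.2])
  have hta : t < a := by
    refine ht.lt_of_ne ?_
    rintro rfl
    rw [_root_.abs_le] at hts
    linarith [hts.1, hend.2]
  obtain ⟨r, hr, e⟩ := exists_eq_of_step hE (c := D t) (by lia) (by have := hlt t hta; lia)
  have := S.height_eq_one hn hm (heq t ht r hr e.symm) hts (by rw [hv.leg_eq t ht, hi])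
  rw [hw.leg_eq r hr] at this
  exact hj this

/-- Two descents in different legs cannot start from a common vertex, in the same direction,
and stay in one leg of the `m`-od. -/
theorem Descent.false_of_single {S : Factorization n m X} (hn : 3 ≤ n) (hm : m < n) {s s' : ℕ}
    {i j : Fin n} {v w : ℕ → X} {a b : ℕ} (hv : S.Descent s i v a) (hw : S.Descent s j w b)
    {q : Fin m} {r : ℕ} (hv0 : S.φ (v 0) = Pi.single q r) (hw0 : S.φ (w 0) = Pi.single q r)
    (hvs : ∀ t ≤ a, S.φ (v t) = Pi.single q (S.φ (v t) q))
    (hws : ∀ t ≤ b, S.φ (w t) = Pi.single q (S.φ (w t) q))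
    (hside : ((∀ t, 0 < t → t ≤ a → r < S.φ (v t) q) ∧ ∀ t, 0 < t → t ≤ b → r < S.φ (w t) q) ∨
      ((∀ t, 0 < t → t ≤ a → S.φ (v t) q < r) ∧ ∀ t, 0 < t → t ≤ b → S.φ (w t) q < r))
    (hs : s < s') (hi : height i s' = 1) (hj : height j s' ≠ 1) (h0 : s' ≤ S.u (v 0)) :
    False := by
  have ev : S.φ (v 0) q = r := by simp [hv0]
  have ew : S.φ (w 0) q = r := by simp [hw0]
  refine hv.false_of_depth hn hm hw (D := fun t => (S.φ (v t) q - r) + (r - S.φ (v t) q))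
    (E := fun t => (S.φ (w t) q - r) + (r - S.φ (w t) q)) (by simp [ev]) (by simp [ew])
    (fun t ht => ?_) (fun t ht => ?_) (fun t ht t' ht' h => ?_) hs hi hj h0
  · have h1 := (S.near _ _ (hv.walk t ht)).apply_le q
    have h2 := (S.near _ _ (hv.walk t ht)).symm.apply_le q
    lia
  · have h1 := (S.near _ _ (hw.walk t ht)).apply_le q
    have h2 := (S.near _ _ (hw.walk t ht)).symm.apply_le q
    lia
  · rw [hvs t ht, hws t' ht']
    congr 1
    rcases Nat.eq_zero_or_pos t with rfl | hp <;> rcases Nat.eq_zero_or_pos t' with rfl | hp'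
    · rw [ev, ew]
    · lia
    · lia
    · rcases hside with ⟨h1, h2⟩ | ⟨h1, h2⟩
      · have := h1 t hp ht
        have := h2 t' hp' ht'
        lia
      · have := h1 t hp ht
        have := h2 t' hp' ht'
        lia

/-- The reversal of a walk. -/
theorem walk_reverse {w : ℕ → X} {L : ℕ} (hw : ∀ t < L, S.adj (w t) (w (t + 1))) :
    ∀ t < L, S.adj (w (L - t)) (w (L - (t + 1))) := by
  intro t ht
  have := S.symm _ _ (hw (L - (t + 1)) (by lia))
  rwa [show L - (t + 1) + 1 = L - t by lia] at this

/-- A statement about the ends of closed walks follows from the case of excursions. -/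
theorem leg_eq_of_excursion {v₀ : Fin m → ℕ}
    (hsmall : ∀ x y, S.φ x = v₀ → S.adj x y → S.leg x = S.leg y)
    (hexc : ∀ (L : ℕ) (w : ℕ → X), (∀ t < L, S.adj (w t) (w (t + 1))) → S.φ (w 0) = v₀ →
      S.φ (w L) = v₀ → 2 ≤ L → (∀ t, 0 < t → t < L → S.φ (w t) ≠ v₀) →
      S.leg (w 0) = S.leg (w L)) {x y : X} (hx : S.φ x = v₀) (hy : S.φ y = v₀) :
    S.leg x = S.leg y := by
  obtain ⟨L, w, hw, h0, hL⟩ := exists_walk (S.conn x y)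
  rw [← h0] at hx ⊢
  rw [← hL] at hy ⊢
  clear h0 hL
  induction L using Nat.strong_induction_on generalizing w with
  | _ L ih =>
    by_cases hmid : ∃ t, 0 < t ∧ t < L ∧ S.φ (w t) = v₀
    · obtain ⟨t, ht0, htL, ht⟩ := hmid
      have e1 := ih t htL w ht hx (fun r hr => hw r (by lia))
      have e2 := ih (L - t) (by lia) (fun r => w (t + r))
        (by simpa [show t + (L - t) = L by lia] using hy) (by simpa using ht)
        (fun r hr => hw (t + r) (by lia))
      simp only [add_zero] at e2
      rw [show t + (L - t) = L by lia] at e2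
      exact e1.trans e2
    · push Not at hmid
      rcases Nat.lt_or_ge L 2 with hL | hL
      · interval_cases L
        · rfl
        · exact hsmall _ _ hx (hw 0 (by lia))
      · exact hexc L w hw hx hy hL hmid

theorem Descent.lt_of_lt_u {S : Factorization n m X} {s : ℕ} {i : Fin n} {w : ℕ → X} {a L : ℕ}
    (h : S.Descent s i w a) (ha : a ≤ L) (hL : s + 1 ≤ S.u (w L)) : a < L := by
  refine ha.lt_of_ne ?_
  rintro rfl
  have := h.at_end.abs_le
  rw [_root_.abs_le] at this
  linarith [this.2]

theorem leg_eq_of_eq_zero (hn : 3 ≤ n) (hm : m < n) (hu : ∀ x, S.φ x = 0 → n + 1 ≤ S.u x)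
    {x y : X} (hx : S.φ x = 0) (hy : S.φ y = 0) : S.leg x = S.leg y := by
  have hn3 : (3 : ℝ) ≤ n := by exact_mod_cast hn
  refine S.leg_eq_of_excursion (v₀ := 0) (fun x y hx h => ?_) (fun L w hw h0 hL hL2 hne => ?_) hx hy
  · exact (S.leg_step _ _ h).resolve_right (by have := hu x hx; linarith)
  by_contra hleg
  have u0 := hu _ h0
  have uL := hu _ hL
  have hs : ((0 : ℕ) : ℝ) = 0 := Nat.cast_zero
  obtain ⟨q, r, e, hside⟩ := exists_side (w := fun t => S.φ (w t))
    (fun t ht => S.near _ _ (hw t ht)) hL2 (fun t h1 h2 => by simpa [h0] using hne t h1 h2)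
  have hr : r = 0 := by
    have := congrFun (h0.symm.trans e) q
    simpa using this.symm
  subst hr
  have hside : ∀ t, 0 < t → t < L → 0 < S.φ (w t) q := by
    rcases hside with h | h
    · exact h
    · exact fun t h1 h2 => absurd (h t h1 h2) (by simp)
  obtain ⟨a, ha, hA⟩ := S.exists_descent (s := 0) hw (by linarith) hleg
  obtain ⟨b, hb, hB⟩ := S.exists_descent (s := 0) (w := fun t => w (L - t)) (L := L)
    (S.walk_reverse hw) (by simp only [Nat.sub_zero]; linarith) (by simpa using Ne.symm hleg)
  simp only [Nat.sub_zero] at hB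
  have ha := hA.lt_of_lt_u ha (by linarith)
  have hb := hB.lt_of_lt_u hb (by simp only [Nat.sub_self]; linarith)
  have hsing : ∀ t < L, S.φ (w t) = Pi.single q (S.φ (w t) q) := by
    intro t ht
    rcases Nat.eq_zero_or_pos t with rfl | hp
    · rw [h0]; simp
    · exact (S.near _ _ (hw t ht)).eq_single_left (hside t hp ht)
  have hsingL : ∀ t ≤ L, S.φ (w t) = Pi.single q (S.φ (w t) q) := by
    intro t ht
    rcases ht.lt_or_eq with ht | rfl
    · exact hsing t ht
    · rw [hL]; simp
  refine hA.false_of_single hn hm hB (q := q) (r := 0) (by simpa using h0) (by simpa using hL)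
    (fun t ht => hsingL t (by lia)) (fun t ht => hsingL _ (by lia))
    (Or.inl ⟨fun t h1 h2 => hside t h1 (by lia), fun t h1 h2 => hside _ (by lia) (by lia)⟩)
    (s' := S.leg (w L) + 1) (by lia) (height_first.2 hleg) (by simp [height_first]) ?_
  have : ((S.leg (w L) : ℕ) : ℝ) + 1 ≤ n := by exact_mod_cast (S.leg (w L)).2
  push_cast
  linarith

/-- If a descent towards the branch vertex of the `m`-od reaches it, a parallel one does so. -/
theorem Descent.exists_eq_zero {S : Factorization n m X} (hn : 3 ≤ n) (hm : m < n) {s : ℕ}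
    {i j : Fin n} {v w : ℕ → X} {a b : ℕ} (hv : S.Descent s i v a) (hw : S.Descent s j w b)
    {q : Fin m} {r : ℕ} (hv0 : S.φ (v 0) = Pi.single q r) (hw0 : S.φ (w 0) = Pi.single q r)
    (hws : ∀ t, 0 < t → t ≤ b → S.φ (w t) q < r) (hb : 0 < b)
    (hz : ∃ t ≤ a, S.φ (v t) = 0) : ∃ t ≤ b, S.φ (w t) = 0 := by
  classical
  by_contra! hne
  have h1 := eq_single_of_ne_zero (w := fun t => S.φ (w t)) (fun t ht => S.near _ _ (hw.walk t ht))
    hw0 (fun t _ ht => hne t ht) (Or.inr hws) b le_rfl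
  have h2 := hne b le_rfl
  have h3 := hws b hb le_rfl
  set d := S.φ (w b) q with hd
  have hd0 : d ≠ 0 := by
    intro h0
    rw [h0, Pi.single_zero] at h1
    exact h2 h1
  obtain ⟨z, hza, hz⟩ := hz
  have hex : ∃ t, S.φ (v t) q ≤ d := ⟨z, by simp [hz]⟩
  have hle : Nat.find hex ≤ z := Nat.find_min' hex (by simp [hz])
  have hspec := Nat.find_spec hex
  rcases e : Nat.find hex with _ | t
  · rw [e, hv0, Pi.single_eq_same] at hspec
    lia
  · have hmin := Nat.find_min hex (m := t) (by lia)
    rw [e] at hspec hle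
    have hn1 := S.near _ _ (hv.walk t (by lia))
    have h4 := hn1.symm.apply_le q
    have h5 : S.φ (v (t + 1)) = Pi.single q d := by
      rw [hn1.eq_single (q := q) (by lia)]
      congr 1
      lia
    have h6 : t + 1 ≠ z := by
      rintro rfl
      have := congrFun (hz.symm.trans h5) q
      simp at this
      exact hd0 this.symm
    exact hv.not_at (t + 1) (by lia) (hw.at_end.congr hn hm (h1.trans h5.symm))

theorem leg_eq_of_le_u (hn : 3 ≤ n) (hm : m < n) {v₀ : Fin m → ℕ}
    (hu : ∀ x, S.φ x = v₀ → 7 * n ≤ S.u x)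
    {x y : X} (hx : S.φ x = v₀) (hy : S.φ y = v₀) : S.leg x = S.leg y := by
  have hn3 : (3 : ℝ) ≤ n := by exact_mod_cast hn
  refine S.leg_eq_of_excursion (v₀ := v₀) (fun x y hx h => ?_) (fun L w hw h0 hL hL2 hne => ?_)
    hx hy
  · exact (S.leg_step _ _ h).resolve_right (by have := hu x hx; linarith)
  by_contra hleg
  have u0 := hu _ h0
  have uL := hu _ hL
  have hs : ((3 * n : ℕ) : ℝ) = 3 * n := by push_cast; rfl
  obtain ⟨q, r, e, hside⟩ := exists_side (w := fun t => S.φ (w t))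
    (fun t ht => S.near _ _ (hw t ht)) hL2 (fun t h1 h2 => by simpa [h0] using hne t h1 h2)
  have eL : S.φ (w L) = Pi.single q r := hL.trans (h0.symm.trans e)
  obtain ⟨a, ha, hA⟩ := S.exists_descent (s := 3 * n) hw (by linarith) hleg
  obtain ⟨b, hb, hB⟩ := S.exists_descent (s := 3 * n) (w := fun t => w (L - t)) (L := L)
    (S.walk_reverse hw) (by simp only [Nat.sub_zero]; linarith) (by simpa using Ne.symm hleg)
  simp only [Nat.sub_zero] at hB
  have ha := hA.lt_of_lt_u ha (by linarith)
  have hb := hB.lt_of_lt_u hb (by simp only [Nat.sub_self]; linarith)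
  have not_zero : ∀ (w' : ℕ → X) (i : Fin n) (c : ℕ), S.Descent (3 * n) i w' c →
      S.φ (w' 0) = v₀ → 0 < c := by
    intro w' i c h h0'
    by_contra! hc
    obtain rfl : c = 0 := by lia
    have h1 := h.at_end.abs_le
    have h2 := hu _ h0'
    rw [_root_.abs_le] at h1
    linarith [h1.2]
  have ha0 := not_zero _ _ _ hA h0
  have hb0 := not_zero _ _ _ hB (by simpa using hL)
  have hfin : ∀ (hsA : ∀ t ≤ a, S.φ (w t) = Pi.single q (S.φ (w t) q))
      (hsB : ∀ t ≤ b, S.φ (w (L - t)) = Pi.single q (S.φ (w (L - t)) q)), False := by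
    intro hsA hsB
    refine hA.false_of_single hn hm hB (q := q) (r := r) e (by simpa using eL) hsA hsB ?_
      (s' := 5 * n + S.leg (w L)) (by lia) (height_second.2 hleg) (by simp [height_second]) ?_
    · rcases hside with h | h
      · exact Or.inl ⟨fun t h1 h2 => h t h1 (by lia), fun t h1 h2 => h _ (by lia) (by lia)⟩
      · exact Or.inr ⟨fun t h1 h2 => h t h1 (by lia), fun t h1 h2 => h _ (by lia) (by lia)⟩
    · have : ((S.leg (w L) : ℕ) : ℝ) + 1 ≤ n := by exact_mod_cast (S.leg (w L)).2
      push_cast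
      linarith
  rcases hside with hup | hdown
  · have hsing : ∀ t ≤ L, S.φ (w t) = Pi.single q (S.φ (w t) q) := by
      intro t ht
      rcases ht.lt_or_eq with ht | rfl
      · rcases Nat.eq_zero_or_pos t with rfl | hp
        · rw [e]; simp
        · exact (S.near _ _ (hw t ht)).eq_single_left (by have := hup t hp ht; lia)
      · rw [eL]; simp
    exact hfin (fun t ht => hsing t (by lia)) (fun t ht => hsing _ (by lia))
  · by_cases hz : (∃ t ≤ a, S.φ (w t) = 0) ∨ ∃ t ≤ b, S.φ (w (L - t)) = 0
    · have hz : (∃ t ≤ a, S.φ (w t) = 0) ∧ ∃ t ≤ b, S.φ (w (L - t)) = 0 := by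
        rcases hz with h | h
        · exact ⟨h, hA.exists_eq_zero hn hm hB e (by simpa using eL)
            (fun t h1 h2 => hdown _ (by lia) (by lia)) hb0 h⟩
        · exact ⟨hB.exists_eq_zero hn hm hA (by simpa using eL) e
            (fun t h1 h2 => hdown _ (by lia) (by lia)) ha0 h, h⟩
      obtain ⟨⟨t, ht, ezt⟩, r, hr, ezr⟩ := hz
      have l1 := hA.le_u (by linarith) ht
      have hlow : ∀ x, S.φ x = 0 → n + 1 ≤ S.u x := by
        intro x hx
        have := S.u_close hn hm (hx.trans ezt.symm)
        rw [abs_lt] at this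
        linarith [this.1]
      have := S.leg_eq_of_eq_zero hn hm hlow ezt ezr
      rw [hA.leg_eq t ht] at this
      have h2 := hB.leg_eq r hr
      exact hleg (this.trans h2)
    · push Not at hz
      exact hfin
        (eq_single_of_ne_zero (w := fun t => S.φ (w t)) (fun t ht => S.near _ _ (hA.walk t ht)) e
          (fun t _ ht => hz.1 t ht) (Or.inr fun t h1 h2 => hdown t h1 (by lia)))
        (eq_single_of_ne_zero (w := fun t => S.φ (w (L - t)))
          (fun t ht => S.near _ _ (hB.walk t ht)) (by simpa using eL)
          (fun t _ ht => hz.2 t ht) (Or.inr fun t h1 h2 => hdown _ (by lia) (by lia)))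

/-- A fibre of a factorisation of `F` has small height, and lies in one leg if it is high. -/
theorem leg_eq (hn : 3 ≤ n) (hm : m < n) {x y : X} (h : S.φ x = S.φ y) (hx : 8 * n ≤ S.u x) :
    S.leg x = S.leg y := by
  have hn3 : (3 : ℝ) ≤ n := by exact_mod_cast hn
  have hlow : ∀ z, S.φ z = S.φ x → 7 * n ≤ S.u z := by
    intro z hz
    have := S.u_close hn hm hz
    rw [abs_lt] at this
    linarith [this.1]
  exact S.leg_eq_of_le_u hn hm hlow rfl h.symm

end Factorization

/-! ### The simple `n`-od in `ℝⁿ` -/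

/-- The simple `n`-od whose legs are unit segments on the coordinate axes of `ℝⁿ`. -/
def od (n : ℕ) : Set (Fin n → ℝ) := {x | ∃ i, ∃ r ∈ Set.Icc (0 : ℝ) 1, x = Pi.single i r}

section

variable {n : ℕ}

theorem norm_single_eq (i : Fin n) {r : ℝ} (hr : 0 ≤ r) :
    ‖(Pi.single i r : Fin n → ℝ)‖ = r := by
  rw [Pi.norm_single, Real.norm_of_nonneg hr]

theorem norm_mem_Icc (x : od n) : ‖x.1‖ ∈ Set.Icc (0 : ℝ) 1 := by
  obtain ⟨x, i, r, hr, rfl⟩ := x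
  simpa only [norm_single_eq i hr.1] using hr

/-- A leg containing the point `x`. -/
noncomputable def legOf (x : od n) : Fin n := x.2.choose

theorem eq_single_legOf (x : od n) : x.1 = Pi.single (legOf x) ‖x.1‖ := by
  obtain ⟨r, hr, h⟩ := x.2.choose_spec
  have : ‖x.1‖ = r := by rw [h, norm_single_eq _ hr.1]
  rw [this]
  exact h

/-- The point at distance `r` from the branch point on the `i`-th leg. -/
noncomputable def mk (i : Fin n) (r : ℝ) : od n :=
  ⟨Pi.single i (max 0 (min 1 r)), i, _, ⟨le_max_left _ _, max_le zero_le_one (min_le_left _ _)⟩,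
    rfl⟩

theorem coe_mk {r : ℝ} (i : Fin n) (hr : r ∈ Set.Icc (0 : ℝ) 1) : (mk i r).1 = Pi.single i r := by
  simp only [mk]
  rw [min_eq_right hr.2, max_eq_right hr.1]

theorem continuous_mk (i : Fin n) : Continuous (mk i) := by
  refine Continuous.subtype_mk ?_ _
  exact (continuous_single i).comp (by fun_prop)

theorem mk_legOf (x : od n) : mk (legOf x) ‖x.1‖ = x := by
  apply Subtype.ext
  rw [coe_mk _ (norm_mem_Icc x)]
  exact (eq_single_legOf x).symm

theorem mk_zero (i j : Fin n) : mk i 0 = mk j 0 := by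
  apply Subtype.ext
  simp [coe_mk]

theorem abs_norm_sub_le (x y : od n) : |‖x.1‖ - ‖y.1‖| ≤ dist x y := by
  have := abs_norm_sub_norm_le x.1 y.1
  rwa [← dist_eq_norm] at this

theorem abs_apply_sub_le (x y : od n) (i : Fin n) : |x.1 i - y.1 i| ≤ dist x y := by
  have := dist_le_pi_dist x.1 y.1 i
  rwa [Real.dist_eq] at this

theorem legOf_eq_or (x y : od n) : legOf x = legOf y ∨ ‖x.1‖ ≤ dist x y := by
  by_cases h : legOf x = legOf y
  · exact Or.inl h
  · right
    have h1 := abs_apply_sub_le x y (legOf x)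
    have h2 := congrFun (eq_single_legOf x) (legOf x)
    have h3 := congrFun (eq_single_legOf y) (legOf x)
    rw [Pi.single_eq_same] at h2
    rw [Pi.single_eq_of_ne h] at h3
    rw [h2, h3, sub_zero] at h1
    exact (le_abs_self _).trans h1

theorem dist_le_of_norm_le {x y : od n} {c : ℝ} (hx : ‖x.1‖ ≤ c) (hy : ‖y.1‖ ≤ c) :
    dist x y ≤ c := by
  rw [Subtype.dist_eq, dist_pi_le_iff ((norm_nonneg _).trans hx)]
  intro i
  have h : ∀ z : od n, ‖z.1‖ ≤ c → z.1 i ∈ Set.Icc 0 c := by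
    intro z hz
    refine ⟨?_, (le_abs_self _).trans ((norm_le_pi_norm z.1 i).trans hz)⟩
    rw [eq_single_legOf z]
    have h0 : (0 : Fin n → ℝ) ≤ Pi.single (legOf z) ‖z.1‖ :=
      Pi.single_nonneg.2 (norm_nonneg z.1)
    exact h0 i
  have h1 := h x hx
  have h2 := h y hy
  rw [Real.dist_eq, abs_le]
  constructor <;> linarith [h1.1, h1.2, h2.1, h2.2]

theorem dist_of_legOf_eq {x y : od n} (h : legOf x = legOf y) :
    dist x y = |‖x.1‖ - ‖y.1‖| := by
  refine le_antisymm ?_ (abs_norm_sub_le x y)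
  rw [Subtype.dist_eq, dist_eq_norm]
  conv_lhs => rw [eq_single_legOf x, eq_single_legOf y, h, ← Pi.single_sub, Pi.norm_single]
  rw [Real.norm_eq_abs]

instance compactSpace_od : CompactSpace (od n) := by
  rw [← isCompact_iff_compactSpace]
  have : od n = ⋃ i : Fin n, (fun r : ℝ => (Pi.single i r : Fin n → ℝ)) '' Set.Icc (0 : ℝ) 1 := by
    ext x
    simp only [od, Set.mem_ofPred_eq, Set.mem_iUnion, Set.mem_image]
    refine exists_congr fun i => exists_congr fun r => and_congr_right fun _ => eq_comm
  rw [this]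
  exact isCompact_iUnion fun i => isCompact_Icc.image (continuous_single (A := fun _ => ℝ) i)

theorem isPreconnected_apply_le (i : Fin n) {c : ℝ} (hc : 0 ≤ c) :
    IsPreconnected {x : od n | x.1 i ≤ c} := by
  refine isPreconnected_of_forall (mk i 0) fun y hy => ?_
  refine ⟨mk (legOf y) '' Set.Icc 0 ‖y.1‖, ?_, ⟨0, ⟨le_rfl, norm_nonneg _⟩, mk_zero _ _⟩,
    ⟨‖y.1‖, ⟨norm_nonneg _, le_rfl⟩, mk_legOf y⟩,
    isPreconnected_Icc.image _ (continuous_mk _).continuousOn⟩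
  rintro _ ⟨r, hr, rfl⟩
  have hy1 := norm_mem_Icc y
  simp only [Set.mem_ofPred_eq]
  rw [coe_mk _ ⟨hr.1, hr.2.trans hy1.2⟩]
  by_cases h : legOf y = i
  · subst h
    rw [Pi.single_eq_same]
    simp only [Set.mem_ofPred_eq] at hy
    rw [eq_single_legOf y, Pi.single_eq_same] at hy
    exact hr.2.trans hy
  · rw [Pi.single_eq_of_ne (Ne.symm h)]
    exact hc

instance preconnectedSpace_od : PreconnectedSpace (od n) := by
  refine ⟨?_⟩
  rcases isEmpty_or_nonempty (Fin n) with h | ⟨⟨i⟩⟩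
  · have : IsEmpty (od n) := ⟨fun x => h.elim (legOf x)⟩
    rw [Set.univ_eq_empty_iff.2 this]
    exact isPreconnected_empty
  · convert isPreconnected_apply_le i zero_le_one
    symm
    rw [Set.eq_univ_iff_forall]
    exact fun x => (le_abs_self _).trans ((norm_le_pi_norm x.1 i).trans (norm_mem_Icc x).2)

/-! ### The identity of a simple `n`-od does not factor -/

theorem exists_between_of_three {n : ℕ} (hn : 3 ≤ n) (a : Fin n → ℕ) :
    ∃ i j k, j ≠ i ∧ k ≠ i ∧ a k ≤ a i ∧ a i ≤ a j := by
  let z : Fin n := ⟨0, by lia⟩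
  let o : Fin n := ⟨1, by lia⟩
  let t : Fin n := ⟨2, by lia⟩
  have h1 : z ≠ o := by simp [z, o]
  have h2 : z ≠ t := by simp [z, t]
  have h3 : o ≠ t := by simp [o, t]
  rcases le_total (a z) (a o) with e1 | e1 <;> rcases le_total (a z) (a t) with e2 | e2 <;>
    rcases le_total (a o) (a t) with e3 | e3
  · exact ⟨o, t, z, h3.symm, h1, e1, e3⟩
  · exact ⟨t, o, z, h3, h2, e2, e3⟩
  · exact ⟨z, o, t, h1.symm, h2.symm, e2, e1⟩
  · exact ⟨z, o, t, h1.symm, h2.symm, e2, e1⟩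
  · exact ⟨z, t, o, h2.symm, h1.symm, e1, e2⟩
  · exact ⟨z, t, o, h2.symm, h1.symm, e1, e2⟩
  · exact ⟨t, z, o, h2, h3, e3, e2⟩
  · exact ⟨o, z, t, h1, h3.symm, e3, e1⟩

theorem false_of_small_fibres {m : ℕ} (hn : 3 ≤ n) (hm : m < n) {φ : od n → Fin m → ℕ}
    {adj : od n → od n → Prop} (hsingle : ∀ x, ∃ q a, φ x = Pi.single q a)
    (hnear : ∀ x y, adj x y → Near (φ x) (φ y))
    (hchain : ∀ C : Set (od n), IsPreconnected C → ∀ x ∈ C, ∀ y ∈ C,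
      Relation.ReflTransGen (fun x y => adj x y ∧ x ∈ C ∧ y ∈ C) x y)
    (hclose : ∀ x y, φ x = φ y → dist x y ≤ 1 / 16) : False := by
  have htip : ∀ i j : Fin n, (mk i 1).1 j = if j = i then 1 else 0 := by
    intro i j
    rw [coe_mk i ⟨zero_le_one, le_rfl⟩, Pi.single_apply]
  have hnot : ∀ i x, x.1 i ≤ 1 / 4 → φ x ≠ φ (mk i 1) := by
    intro i x hx h
    have h1 := (abs_apply_sub_le x (mk i 1) i).trans (hclose _ _ h)
    rw [htip, if_pos rfl, abs_le] at h1
    linarith [h1.1]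
  -- the tip of one leg is not between the tip of another and a point off the former
  have tips : ∀ (i j : Fin n) (q : Fin m) (a b : ℕ) (z : od n), i ≠ j →
      φ (mk i 1) = Pi.single q a → φ (mk j 1) = Pi.single q b → 0 < a → a ≤ b →
      z.1 i ≤ 1 / 4 → φ z q ≤ a → False := by
    intro i j q a b z hij hi hj ha hab hz hzq
    obtain ⟨L, w, hw, h0, hL⟩ := exists_walk (hchain {x | x.1 i ≤ 1 / 4}
      (isPreconnected_apply_le i (by norm_num)) z hz (mk j 1)
      (by simp only [Set.mem_ofPred_eq]; rw [htip, if_neg hij]; norm_num))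
    obtain ⟨t, ht, e⟩ := exists_eq_of_step (D := fun t => φ (w t) q) (c := a)
      (fun t ht => (hnear _ _ (hw t ht).1).apply_le q) (by rw [h0]; exact hzq)
      (by simp only [hL, hj, Pi.single_eq_same]; exact hab)
    have hwt : φ (w t) = Pi.single q a := by
      obtain ⟨p, c, hp⟩ := hsingle (w t)
      by_cases hpq : q = p
      · subst hpq
        rw [hp] at e ⊢
        simp only [Pi.single_eq_same] at e
        rw [e]
      · rw [hp, Pi.single_eq_of_ne hpq] at e
        lia
    have hmem : (w t).1 i ≤ 1 / 4 := by
      rcases ht.lt_or_eq with ht | rfl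
      · exact (hw t ht).2.1
      · rw [hL, htip, if_neg hij]; norm_num
    exact hnot i (w t) hmem (hwt.trans hi.symm)
  have same : ∀ C : Set (od n), IsPreconnected C → (∀ x ∈ C, φ x ≠ 0) → ∀ x ∈ C, ∀ y ∈ C,
      ∀ q, φ x = Pi.single q (φ x q) → φ y = Pi.single q (φ y q) := by
    intro C hC hne x hx y hy q hq
    have := hchain C hC x hx y hy
    induction this with
    | refl => exact hq
    | tail _ h ih =>
      have ih := ih h.2.1
      refine (hnear _ _ h.1).eq_single (Nat.pos_of_ne_zero fun h0 => hne _ h.2.1 ?_)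
      rw [ih, h0, Pi.single_zero]
  have pos : ∀ x q, φ x ≠ 0 → φ x = Pi.single q (φ x q) → 0 < φ x q := by
    intro x q hx h
    refine Nat.pos_of_ne_zero fun h0 => hx ?_
    rw [h, h0, Pi.single_zero]
  have pair : ∀ (i j : Fin n) (q : Fin m) (z : od n), i ≠ j → z.1 i ≤ 1 / 4 → z.1 j ≤ 1 / 4 →
      φ z = 0 → φ (mk i 1) = Pi.single q (φ (mk i 1) q) →
      φ (mk j 1) = Pi.single q (φ (mk j 1) q) → False := by
    intro i j q z hij hzi hzj hz hi hj
    have pi := pos _ q (fun h => hnot i z hzi (hz.trans h.symm)) hi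
    have pj := pos _ q (fun h => hnot j z hzj (hz.trans h.symm)) hj
    rcases le_total (φ (mk i 1) q) (φ (mk j 1) q) with h | h
    · exact tips i j q _ _ z hij hi hj pi h hzi (by simp [hz])
    · exact tips j i q _ _ z hij.symm hj hi pj h hzj (by simp [hz])
  by_cases hzero : ∃ z, φ z = 0
  · obtain ⟨z, hz⟩ := hzero
    have hzl : ∀ i, i ≠ legOf z → z.1 i = 0 := by
      intro i hi
      rw [eq_single_legOf z, Pi.single_eq_of_ne hi]
    rcases le_or_gt (z.1 (legOf z)) (1 / 4) with hs | hs
    · have hz4 : ∀ i, z.1 i ≤ 1 / 4 := by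
        intro i
        by_cases h : i = legOf z
        · rw [h]; exact hs
        · rw [hzl i h]; norm_num
      choose q a hqa using fun i : Fin n => hsingle (mk i 1)
      have hqs : ∀ i, φ (mk i 1) = Pi.single (q i) (φ (mk i 1) (q i)) := by
        intro i; rw [hqa]; simp
      obtain ⟨i, j, hij, hq⟩ := Fintype.exists_ne_map_eq_of_card_lt q (by simpa using hm)
      exact pair i j (q i) z hij (hz4 i) (hz4 j) hz (hqs i) (hq ▸ hqs j)
    · have hlt : ∀ l : Fin n, ∃ i j : Fin n, i ≠ j ∧ i ≠ l ∧ j ≠ l := by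
        intro l
        obtain ⟨i, hi, hil⟩ := Fintype.exists_ne_of_one_lt_card (α := Fin n) (by simp; lia) l |>.imp
          fun i hi => (⟨hi, trivial⟩ : i ≠ l ∧ True)
        have : ({l, i} : Finset (Fin n)).card < (Finset.univ : Finset (Fin n)).card := by
          have := Finset.card_le_two (a := l) (b := i)
          simp
          lia
        obtain ⟨j, -, hj⟩ := Finset.exists_mem_notMem_of_card_lt_card this
        simp only [Finset.mem_insert, Finset.mem_singleton, not_or] at hj
        exact ⟨i, j, Ne.symm hj.2, hi, hj.1⟩
      obtain ⟨i, j, hij, hi, hj⟩ := hlt (legOf z)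
      have hne : ∀ x ∈ {x : od n | x.1 (legOf z) ≤ 1 / 8}, φ x ≠ 0 := by
        intro x hx h0
        have h1 := (abs_apply_sub_le x z (legOf z)).trans (hclose _ _ (h0.trans hz.symm))
        rw [abs_le] at h1
        simp only [Set.mem_ofPred_eq] at hx
        linarith [h1.1]
      have hmem : ∀ k, k ≠ legOf z → mk k 1 ∈ {x : od n | x.1 (legOf z) ≤ 1 / 8} := by
        intro k hk
        simp only [Set.mem_ofPred_eq]
        rw [htip, if_neg (Ne.symm hk)]
        norm_num
      obtain ⟨q, a, hqa⟩ := hsingle (mk i 1)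
      have hqi : φ (mk i 1) = Pi.single q (φ (mk i 1) q) := by rw [hqa]; simp
      exact pair i j q z hij (by rw [hzl i hi]; norm_num) (by rw [hzl j hj]; norm_num) hz hqi
        (same _ (isPreconnected_apply_le _ (by norm_num)) hne _ (hmem i hi) _ (hmem j hj) q hqi)
  · push Not at hzero
    let z : od n := mk ⟨0, by lia⟩ 0
    obtain ⟨q, a, hqa⟩ := hsingle z
    have hall : ∀ y, φ y = Pi.single q (φ y q) := fun y =>
      same Set.univ isPreconnected_univ (fun x _ => hzero x) z trivial y trivial q
        (by rw [hqa]; simp)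
    obtain ⟨i, j, k, hj, hk, h1, h2⟩ := exists_between_of_three hn (fun i => φ (mk i 1) q)
    exact tips i j q _ _ (mk k 1) hj.symm (hall _) (hall _) (pos _ q (hzero _) (hall _)) h2
      (by rw [htip, if_neg (Ne.symm hk)]; norm_num) h1

end

/-! ### The bonding map -/

section

variable {n : ℕ}

theorem two_hundred_mul_mem {r : ℝ} (hr : r ∈ Set.Icc (0 : ℝ) 1) :
    0 ≤ 200 * n * r ∧ 200 * n * r ≤ 200 * n := by
  have hn : (0 : ℝ) ≤ 200 * n := by positivity
  exact ⟨mul_nonneg hn hr.1, mul_le_of_le_one_right hn hr.2⟩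

theorem height_mul_bump_mem (i : Fin n) (s : ℕ) (t : ℝ) :
    height i s * bump t ∈ Set.Icc (0 : ℝ) 1 :=
  ⟨mul_nonneg (by linarith [half_le_height i s]) (bump_nonneg _),
    mul_le_one₀ (height_le_one _ _) (bump_nonneg _) (bump_le_one _)⟩

theorem height_mul_self {i : Fin n} {k : ℕ} (h2 : 2 ≤ n) (hk : k ≠ 5) (hk1 : k ≠ 1) :
    height i (k * n) = 1 := by
  unfold height
  have h1 := i.2
  rw [if_neg]
  rintro (h | h)
  · rcases k with _ | _ | k
    · lia
    · lia
    · nlinarith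
  · rcases lt_or_gt_of_ne hk with h3 | h3
    · have : (k + 1) * n ≤ 5 * n := Nat.mul_le_mul_right _ h3
      lia
    · have : 6 * n ≤ k * n := Nat.mul_le_mul_right _ h3
      lia

theorem mk_inj {i j : Fin n} {r t : ℝ} (hr : r ∈ Set.Icc (0 : ℝ) 1) (ht : t ∈ Set.Icc (0 : ℝ) 1)
    (h : mk i r = mk j t) : r = t ∧ (i = j ∨ r = 0) := by
  have h1 := congrArg Subtype.val h
  rw [coe_mk i hr, coe_mk j ht] at h1
  have h2 := congrArg norm h1
  rw [norm_single_eq i hr.1, norm_single_eq j ht.1] at h2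
  refine ⟨h2, ?_⟩
  by_cases hij : i = j
  · exact Or.inl hij
  · right
    have := congrFun h1 i
    rwa [Pi.single_eq_same, Pi.single_eq_of_ne hij] at this

variable [NeZero n]

/-- The map that reads `200 * n` letters along each leg. -/
noncomputable def bondFun (x : Fin n → ℝ) : Fin n → ℝ :=
  ∑ s ∈ Finset.range (200 * n + 1), Pi.single (Fin.ofNat n s)
    (bump (200 * n * ‖x‖ - s) - ∑ i, (1 - height i s) * bump (200 * n * x i - s))

theorem bump_eq_zero {t : ℝ} (h : 1 / 2 ≤ |t|) : bump t = 0 :=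
  max_eq_left (by linarith)

theorem bump_zero : bump 0 = 1 := by simp [bump]

theorem continuous_bump : Continuous bump := by unfold bump; fun_prop

theorem continuous_bondFun : Continuous (bondFun (n := n)) := by
  unfold bondFun
  refine continuous_finsetSum _ fun s _ => (continuous_single (A := fun _ => ℝ) _).comp ?_
  refine (continuous_bump.comp (by fun_prop)).sub (continuous_finsetSum _ fun i _ => ?_)
  exact continuous_const.mul (continuous_bump.comp (by fun_prop))

theorem bondFun_single {i : Fin n} {r : ℝ} (hr : r ∈ Set.Icc (0 : ℝ) 1) {s : ℕ}
    (hs : |200 * n * r - s| ≤ 1 / 2) :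
    bondFun (Pi.single i r) =
      Pi.single (Fin.ofNat n s) (height i s * bump (200 * n * r - s)) := by
  have hterm : ∀ t : ℕ, bump (200 * n * ‖(Pi.single i r : Fin n → ℝ)‖ - t) -
      ∑ j, (1 - height j t) * bump (200 * n * (Pi.single i r : Fin n → ℝ) j - t) =
      height i t * bump (200 * n * r - t) := by
    intro t
    rw [norm_single_eq i hr.1, Finset.sum_eq_single i]
    · rw [Pi.single_eq_same]; ring
    · intro j _ hj
      rw [Pi.single_eq_of_ne hj]
      rcases Nat.eq_zero_or_pos t with rfl | ht
      · have : height j 0 = 1 := by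
          unfold height
          rw [if_neg]
          have := Nat.pos_of_ne_zero (NeZero.ne n)
          lia
        rw [this, sub_self, zero_mul]
      · rw [bump_eq_zero, mul_zero]
        have : (1 : ℝ) ≤ t := by exact_mod_cast ht
        rw [abs_of_nonpos] <;> linarith
    · simp
  unfold bondFun
  simp only [hterm]
  rw [Finset.sum_eq_single s]
  · intro t _ ht
    rw [bump_eq_zero, mul_zero, Pi.single_zero]
    have h1 : (1 : ℝ) ≤ |(t : ℝ) - s| := by
      have : (1 : ℤ) ≤ |(t : ℤ) - s| := Int.one_le_abs (by lia)
      exact_mod_cast this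
    have h2 := abs_sub_abs_le_abs_sub ((s : ℝ) - t) (s - 200 * n * r)
    rw [abs_sub_comm (s : ℝ) t, abs_sub_comm (s : ℝ) (200 * n * r)] at h2
    rw [show (s : ℝ) - t - (s - 200 * n * r) = 200 * n * r - t by ring] at h2
    linarith
  · intro h
    exfalso
    simp only [Finset.mem_range, not_lt] at h
    have h1 : (200 * n + 1 : ℝ) ≤ s := by exact_mod_cast h
    have h2 := (two_hundred_mul_mem (n := n) hr).2
    rw [abs_le] at hs
    linarith [hs.1]

theorem exists_nat_near {t : ℝ} (ht : 0 ≤ t) : ∃ s : ℕ, |t - s| ≤ 1 / 2 := by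
  refine ⟨⌊t + 1 / 2⌋₊, ?_⟩
  have h1 := Nat.floor_le (show 0 ≤ t + 1 / 2 by linarith)
  have h2 := Nat.lt_floor_add_one (t + 1 / 2)
  rw [abs_le]
  constructor <;> linarith

theorem bondFun_mem (x : od n) : bondFun x.1 ∈ od n := by
  have hx := norm_mem_Icc x
  obtain ⟨s, hs⟩ := exists_nat_near (two_hundred_mul_mem (n := n) hx).1
  rw [eq_single_legOf x, bondFun_single hx hs]
  exact ⟨_, _, height_mul_bump_mem _ _ _, rfl⟩

/-- The bonding map of the inverse system. -/
noncomputable def bond (x : od n) : od n := ⟨bondFun x.1, bondFun_mem x⟩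

theorem continuous_bond : Continuous (bond (n := n)) :=
  (continuous_bondFun.comp continuous_subtype_val).subtype_mk _

theorem coe_bond (x : od n) {s : ℕ} (hs : |200 * n * ‖x.1‖ - s| ≤ 1 / 2) :
    (bond x).1 = Pi.single (Fin.ofNat n s) (height (legOf x) s * bump (200 * n * ‖x.1‖ - s)) := by
  have hx := norm_mem_Icc x
  rw [← bondFun_single hx hs, ← eq_single_legOf x]
  rfl

theorem bond_mk {i : Fin n} {r : ℝ} (hr : r ∈ Set.Icc (0 : ℝ) 1) {s : ℕ}
    (hs : |200 * n * r - s| ≤ 1 / 2) :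
    bond (mk i r) = mk (Fin.ofNat n s) (height i s * bump (200 * n * r - s)) := by
  apply Subtype.ext
  rw [coe_mk _ (height_mul_bump_mem _ _ _), ← bondFun_single hr hs, ← coe_mk i hr]
  rfl

theorem nz_real : (0 : ℝ) < n := by exact_mod_cast Nat.pos_of_ne_zero (NeZero.ne n)

theorem bond_mk_of_eq {i : Fin n} {r : ℝ} (hr : r ∈ Set.Icc (0 : ℝ) 1) {s : ℕ}
    (hs : 200 * n * r = s) : bond (mk i r) = mk (Fin.ofNat n s) (height i s) := by
  rw [bond_mk hr (s := s) (by rw [hs, sub_self]; norm_num), hs, sub_self, bump_zero, mul_one]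

theorem ofNat_mul_self (k : ℕ) : Fin.ofNat n (k * n) = 0 := by
  ext; simp [Fin.ofNat]

/-- The tip of the first leg. -/
noncomputable def tip (n : ℕ) [NeZero n] : od n := mk 0 1

theorem bond_tip (h2 : 2 ≤ n) : bond (tip n) = tip n := by
  unfold tip
  rw [bond_mk_of_eq (s := 200 * n) ⟨zero_le_one, le_rfl⟩ (by push_cast; ring), ofNat_mul_self,
    height_mul_self h2 (by norm_num) (by norm_num)]

/-- The endpoints of the letters. -/
def nodes (n : ℕ) : Set (od n) := {x | ∃ s : ℕ, 200 * n * ‖x.1‖ = s}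

theorem bond_bond_of_mem_nodes (h2 : 2 ≤ n) {x : od n} (hx : x ∈ nodes n) :
    bond (bond x) = tip n := by
  obtain ⟨s, hs⟩ := hx
  rw [← mk_legOf x, bond_mk_of_eq (norm_mem_Icc x) hs]
  rcases height_eq_half_or (legOf x) s with h | h
  · rw [h, bond_mk_of_eq (s := 100 * n) (by norm_num) (by push_cast; ring), ofNat_mul_self,
      height_mul_self h2 (by norm_num) (by norm_num)]
    rfl
  · rw [h, bond_mk_of_eq (s := 200 * n) (by norm_num) (by push_cast; ring), ofNat_mul_self,
      height_mul_self h2 (by norm_num) (by norm_num)]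
    rfl

/-- The points that read the `s`-th half-letters on the `i`-th leg. -/
def cell (i : Fin n) (s : ℕ) : Set (od n) :=
  {x | ∃ r ∈ Set.Icc (0 : ℝ) 1, x = mk i r ∧ s ≤ 200 * n * r ∧ 200 * n * r ≤ s + 1}

theorem injOn_bond_cell (h2 : 2 ≤ n) (i : Fin n) (s : ℕ) : Set.InjOn bond (cell i s) := by
  have hn := nz_real (n := n)
  have hlet : Fin.ofNat n s ≠ Fin.ofNat n (s + 1) := by
    intro h
    simp only [Fin.ext_iff, Fin.ofNat] at h
    have := (Nat.modEq_iff_dvd' (Nat.le_succ s)).1 h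
    rw [Nat.succ_sub (le_refl s), Nat.sub_self] at this
    have := Nat.le_of_dvd one_pos this
    lia
  have h1 := half_le_height i s
  have h3 := half_le_height i (s + 1)
  -- the image of a point in terms of its position in the letter
  have val : ∀ r ∈ Set.Icc (0 : ℝ) 1, s ≤ 200 * n * r → 200 * n * r ≤ s + 1 →
      (200 * n * r ≤ s + 1 / 2 ∧
        bond (mk i r) = mk (Fin.ofNat n s) (height i s * (1 - 2 * (200 * n * r - s))) ∧
        height i s * (1 - 2 * (200 * n * r - s)) ∈ Set.Icc (0 : ℝ) 1) ∨
      (s + 1 / 2 ≤ 200 * n * r ∧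
        bond (mk i r) =
          mk (Fin.ofNat n (s + 1)) (height i (s + 1) * (1 - 2 * (s + 1 - 200 * n * r))) ∧
        height i (s + 1) * (1 - 2 * (s + 1 - 200 * n * r)) ∈ Set.Icc (0 : ℝ) 1) := by
    intro r hr ha hb
    rcases le_total (200 * n * r) (s + 1 / 2) with h | h
    · left
      have hs : |200 * n * r - s| ≤ 1 / 2 := by rw [abs_le]; constructor <;> linarith
      have hb := bump_of_abs_le hs
      rw [abs_of_nonneg (by linarith)] at hb
      exact ⟨h, by rw [bond_mk hr hs, hb], hb ▸ height_mul_bump_mem _ _ _⟩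
    · right
      have hs : |200 * n * r - (s + 1 : ℕ)| ≤ 1 / 2 := by
        rw [abs_le]; push_cast; constructor <;> linarith
      have hb := bump_of_abs_le hs
      rw [abs_of_nonpos (by push_cast; linarith)] at hb
      push_cast at hb
      have hb' : bump (200 * n * r - (s + 1)) = 1 - 2 * (s + 1 - 200 * n * r) := by
        rw [hb]; ring
      refine ⟨h, ?_, ?_⟩
      · rw [bond_mk hr hs]; push_cast; rw [hb']
      · rw [← hb']; exact height_mul_bump_mem _ _ _
  rintro _ ⟨r, hr, rfl, ha, hb⟩ _ ⟨t, ht, rfl, hc, hd⟩ heq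
  suffices 200 * n * r = 200 * n * t by
    rw [mul_left_cancel₀ (by positivity) this]
  rcases val r hr ha hb with ⟨e1, e2, e3⟩ | ⟨e1, e2, e3⟩ <;>
    rcases val t ht hc hd with ⟨g1, g2, g3⟩ | ⟨g1, g2, g3⟩
  · rw [e2, g2] at heq
    have := mul_left_cancel₀ (by linarith) (mk_inj e3 g3 heq).1
    linarith
  · rw [e2, g2] at heq
    obtain ⟨h4, h5⟩ := mk_inj e3 g3 heq
    have h5 := h5.resolve_left hlet
    rw [h5] at h4
    have h6 := (mul_eq_zero.1 h5).resolve_left (by linarith)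
    have h7 := (mul_eq_zero.1 h4.symm).resolve_left (by linarith)
    linarith
  · rw [e2, g2] at heq
    obtain ⟨h4, h5⟩ := mk_inj e3 g3 heq
    have h5 := h5.resolve_left hlet.symm
    rw [h5] at h4
    have h6 := (mul_eq_zero.1 h5).resolve_left (by linarith)
    have h7 := (mul_eq_zero.1 h4.symm).resolve_left (by linarith)
    linarith
  · rw [e2, g2] at heq
    have := mul_left_cancel₀ (by linarith) (mk_inj e3 g3 heq).1
    linarith

theorem exists_subset_cell {C : Set (od n)} (hC : IsConnected C) (hd : Disjoint C (nodes n)) :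
    ∃ i s, C ⊆ cell i s := by
  obtain ⟨⟨x, hx⟩, hpre⟩ := hC
  have hmem : ∀ y ∈ C, ∀ s : ℕ, 200 * n * ‖y.1‖ ≠ s := by
    intro y hy s hs
    exact Set.disjoint_left.1 hd hy ⟨s, hs⟩
  have hn := nz_real (n := n)
  set i := legOf x with hi
  set s := ⌊200 * n * ‖x.1‖⌋₊ with hs
  have h0 : 0 ≤ 200 * n * ‖x.1‖ := by positivity
  have h1 : s < 200 * n * ‖x.1‖ := lt_of_le_of_ne (Nat.floor_le h0) (hmem x hx s).symm
  have h2 : 200 * n * ‖x.1‖ < s + 1 := Nat.lt_floor_add_one _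
  have hxi : x.1 i = ‖x.1‖ := by
    have := congrFun (eq_single_legOf x) i
    rwa [hi, Pi.single_eq_same] at this
  have happly : ∀ y : od n, 0 < y.1 i → y.1 i = ‖y.1‖ := by
    intro y hy
    have := congrFun (eq_single_legOf y) i
    by_cases h : i = legOf y
    · rw [h] at this ⊢
      rwa [Pi.single_eq_same] at this
    · rw [Pi.single_eq_of_ne h] at this
      linarith
  have cont : ∀ j : Fin n, Continuous fun y : od n => y.1 j := fun j =>
    (continuous_apply j).comp continuous_subtype_val
  have contn : Continuous fun y : od n => ‖y.1‖ := continuous_subtype_val.norm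
  let U : Set (od n) := {y | s < 200 * n * y.1 i} ∩ {y | 200 * n * y.1 i < s + 1}
  let F : Set (od n) := {y | y.1 i = ‖y.1‖} ∩ ({y | s ≤ 200 * n * ‖y.1‖} ∩
    {y | 200 * n * ‖y.1‖ ≤ s + 1})
  have hU : IsOpen U := (isOpen_lt continuous_const (continuous_const.mul (cont i))).inter
    (isOpen_lt (continuous_const.mul (cont i)) continuous_const)
  have hF : IsClosed F := (isClosed_eq (cont i) contn).inter
    ((isClosed_le continuous_const (continuous_const.mul contn)).inter
      (isClosed_le (continuous_const.mul contn) continuous_const))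
  have hUF : U ⊆ F := by
    rintro y ⟨hy1, hy2⟩
    simp only [Set.mem_ofPred_eq] at hy1 hy2
    have hpos : 0 < y.1 i := by
      by_contra! hle
      have : 200 * n * y.1 i ≤ 0 := mul_nonpos_of_nonneg_of_nonpos (by positivity) hle
      have : (0 : ℝ) ≤ s := Nat.cast_nonneg s
      linarith
    have e := happly y hpos
    rw [e] at hy1 hy2
    exact ⟨e, hy1.le, hy2.le⟩
  have hsub : C ⊆ U := by
    refine hpre.subset_left_of_subset_union hU hF.isOpen_compl
      (Set.disjoint_left.2 fun y hy hy' => hy' (hUF hy)) (fun y hy => ?_) ⟨x, hx, ?_⟩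
    · by_cases hyF : y ∈ F
      · left
        obtain ⟨g1, g2, g3⟩ := hyF
        simp only [Set.mem_ofPred_eq] at g1 g2 g3
        constructor
        · simp only [Set.mem_ofPred_eq]
          rw [g1]
          exact lt_of_le_of_ne g2 (hmem y hy s).symm
        · simp only [Set.mem_ofPred_eq]
          rw [g1]
          exact lt_of_le_of_ne g3 (by have := hmem y hy (s + 1); push_cast at this; exact this)
      · right; exact hyF
    · constructor
      · simp only [Set.mem_ofPred_eq]; rw [hxi]; exact h1
      · simp only [Set.mem_ofPred_eq]; rw [hxi]; exact h2
  refine ⟨i, s, fun y hy => ?_⟩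
  obtain ⟨g1, g2, g3⟩ := hUF (hsub hy)
  simp only [Set.mem_ofPred_eq] at g1 g2 g3
  refine ⟨‖y.1‖, norm_mem_Icc y, ?_, g2, g3⟩
  have hpos : 0 < ‖y.1‖ := by
    rcases (norm_nonneg y.1).eq_or_lt with h | h
    · exact absurd (by rw [← h]; simp) (hmem y hy 0)
    · exact h
  have : i = legOf y := by
    by_contra h
    have := congrFun (eq_single_legOf y) i
    rw [Pi.single_eq_of_ne h] at this
    linarith
  rw [this, mk_legOf]

theorem bond_surjective (h2 : 2 ≤ n) (y : od n) : ∃ r ∈ Set.Icc (0 : ℝ) 1, bond (mk 0 r) = y := by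
  have hn := nz_real (n := n)
  have hy := norm_mem_Icc y
  set t := ‖y.1‖ with ht
  set j := legOf y with hj
  have hjn : ((j : ℕ) : ℝ) + 1 ≤ n := by exact_mod_cast j.2
  have hj0 : (0 : ℝ) ≤ ((j : ℕ) : ℝ) := Nat.cast_nonneg _
  set u : ℝ := (10 * n + j : ℕ) + (1 - t) / 2 with hu
  have hur : 200 * n * (u / (200 * n)) = u := by field_simp
  have hu0 : 0 ≤ u := by rw [hu]; push_cast; linarith [hy.2]
  have hr : u / (200 * n) ∈ Set.Icc (0 : ℝ) 1 := by
    refine ⟨by positivity, ?_⟩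
    rw [div_le_one (by positivity), hu]
    push_cast
    have : (1 : ℝ) ≤ n := by linarith
    linarith [hy.1]
  refine ⟨u / (200 * n), hr, ?_⟩
  have habs : |u - (10 * n + j : ℕ)| = (1 - t) / 2 := by
    rw [hu, add_sub_cancel_left, abs_of_nonneg (by linarith [hy.2])]
  rw [bond_mk hr (s := 10 * n + j) (by rw [hur, habs]; linarith [hy.1]), hur,
    bump_of_abs_le (by rw [habs]; linarith [hy.1]), habs]
  have h3 : height (0 : Fin n) (10 * n + j) = 1 := by
    unfold height
    have := j.2
    rw [if_neg]
    simp only [Fin.val_zero]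
    lia
  have h4 : Fin.ofNat n (10 * n + j) = j := by
    ext
    simp [Fin.ofNat, Nat.mod_eq_of_lt j.2]
  rw [h3, h4, show 1 * (1 - 2 * ((1 - t) / 2)) = t by ring]
  exact mk_legOf y

theorem image_bond_bond_cell (h2 : 2 ≤ n) (y : od n) :
    ∃ x ∈ cell (0 : Fin n) (200 * n - 1), bond (bond x) = y := by
  have hn := nz_real (n := n)
  have hn1 : (1 : ℝ) ≤ n := by exact_mod_cast Nat.pos_of_ne_zero (NeZero.ne n)
  obtain ⟨t, ht, rfl⟩ := bond_surjective h2 y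
  set u : ℝ := 200 * n - (1 - t) / 2 with hu
  have hur : 200 * n * (u / (200 * n)) = u := by field_simp
  have hr : u / (200 * n) ∈ Set.Icc (0 : ℝ) 1 := by
    refine ⟨div_nonneg (by linarith [ht.1, ht.2]) (by positivity), ?_⟩
    rw [div_le_one (by positivity)]
    linarith [ht.2]
  have hcast : ((200 * n - 1 : ℕ) : ℝ) = 200 * n - 1 := by
    rw [Nat.cast_sub (by lia)]; push_cast; ring
  refine ⟨mk 0 (u / (200 * n)), ⟨_, hr, rfl, ?_, ?_⟩, ?_⟩
  · rw [hur, hcast]; linarith [ht.1]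
  · rw [hur, hcast]; linarith [ht.2]
  have habs : |u - (200 * n : ℕ)| = (1 - t) / 2 := by
    rw [hu, abs_of_nonpos]
    · push_cast; ring
    · push_cast; linarith [ht.2]
  rw [bond_mk hr (s := 200 * n) (by rw [hur, habs]; linarith [ht.1]), hur,
    bump_of_abs_le (by rw [habs]; linarith [ht.1]), habs, ofNat_mul_self,
    height_mul_self h2 (by norm_num) (by norm_num), show 1 * (1 - 2 * ((1 - t) / 2)) = t by ring]

theorem cell_subset_of_tip_mem {C : Set (od n)} (hC : IsConnected C) (ht : tip n ∈ C)
    (hsub : ¬ C ⊆ cell (0 : Fin n) (200 * n - 1)) : cell (0 : Fin n) (200 * n - 1) ⊆ C := by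
  have hn1 : (1 : ℝ) ≤ n := by exact_mod_cast Nat.pos_of_ne_zero (NeZero.ne n)
  have hn0 : 1 ≤ n := Nat.pos_of_ne_zero (NeZero.ne n)
  have hcast : ((200 * n - 1 : ℕ) : ℝ) = 200 * n - 1 := by
    rw [Nat.cast_sub (by lia)]; push_cast; ring
  rintro _ ⟨r, hr, rfl, h1, -⟩
  rw [hcast] at h1
  by_contra hz
  apply hsub
  have hr0 : 0 < r := by
    by_contra! hle
    have : 200 * n * r ≤ 0 := mul_nonpos_of_nonneg_of_nonpos (by positivity) hle
    linarith
  have happly : ∀ y : od n, 0 < y.1 0 → y = mk 0 (y.1 0) ∧ y.1 0 ∈ Set.Icc (0 : ℝ) 1 := by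
    intro y hy
    have h := congrFun (eq_single_legOf y) 0
    by_cases h0 : 0 = legOf y
    · rw [← h0, Pi.single_eq_same] at h
      rw [h]
      exact ⟨by conv_rhs => rw [h0, mk_legOf], norm_mem_Icc y⟩
    · rw [Pi.single_eq_of_ne h0] at h
      linarith
  have cont : Continuous fun y : od n => y.1 0 := (continuous_apply 0).comp continuous_subtype_val
  have htip : (tip n).1 0 = 1 := by
    unfold tip
    rw [coe_mk _ ⟨zero_le_one, le_rfl⟩, Pi.single_eq_same]
  have hCU : C ⊆ {y : od n | r < y.1 0} := by
    refine hC.2.subset_left_of_subset_union (v := {y : od n | y.1 0 < r})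
      (isOpen_lt continuous_const cont) (isOpen_lt cont continuous_const)
      (Set.disjoint_left.2 fun y hy hy' => by
        simp only [Set.mem_ofPred_eq] at hy hy'
        exact lt_asymm hy hy')
      (fun y hy => ?_) ⟨tip n, ht, ?_⟩
    · rcases lt_trichotomy r (y.1 0) with h | h | h
      · exact Or.inl h
      · exact absurd ((happly y (h ▸ hr0)).1 ▸ hy) (h ▸ hz)
      · exact Or.inr h
    · simp only [Set.mem_ofPred_eq]
      rw [htip]
      refine lt_of_le_of_ne hr.2 ?_
      rintro rfl
      exact hz ht
  intro y hy
  have hy' : r < y.1 0 := hCU hy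
  obtain ⟨e, he⟩ := happly y (hr0.trans hy')
  refine ⟨_, he, e, ?_, ?_⟩
  · rw [hcast]
    have := mul_lt_mul_of_pos_left hy' (show (0 : ℝ) < 200 * n by positivity)
    linarith
  · rw [hcast]
    linarith [(two_hundred_mul_mem (n := n) he).2]

end

/-! ### Inverse limits of a single bonding map -/

/-- The inverse limit of the sequence with all bonding maps equal to `f`. -/
def InvLim {T : Type} (f : T → T) : Type := {x : ℕ → T // ∀ k, f (x (k + 1)) = x k}

namespace InvLim

section

variable {T : Type} {f : T → T}

/-- The coordinate projections of the inverse limit. -/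
def proj (k : ℕ) (x : InvLim f) : T := x.1 k

theorem map_proj (k : ℕ) (x : InvLim f) : f (proj (k + 1) x) = proj k x := x.2 k

theorem ext_proj {x y : InvLim f} (h : ∀ k, proj k x = proj k y) : x = y :=
  Subtype.ext (funext h)

theorem iterate_proj (j k : ℕ) (x : InvLim f) : f^[j] (proj (k + j) x) = proj k x := by
  induction j with
  | zero => rfl
  | succ j ih => rw [Function.iterate_succ_apply, ← add_assoc, map_proj (k + j) x, ih]

theorem proj_eq_of_le {j k : ℕ} (h : j ≤ k) {x y : InvLim f} (hxy : proj k x = proj k y) :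
    proj j x = proj j y := by
  obtain ⟨i, rfl⟩ := Nat.exists_eq_add_of_le h
  rw [← iterate_proj i j x, ← iterate_proj i j y, hxy]

theorem surjective_proj (hf : Function.Surjective f) (k : ℕ) :
    Function.Surjective (proj (f := f) k) := by
  intro y
  obtain ⟨g, hg⟩ := hf.hasRightInverse
  refine ⟨⟨fun j => if j ≤ k then f^[k - j] y else g^[j - k] y, fun j => ?_⟩, ?_⟩
  · rcases lt_trichotomy j k with h | h | h
    · simp only [Nat.succ_le_of_lt h, h.le, if_true]
      rw [← Function.iterate_succ_apply' f]
      congr 1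
      omega
    · subst h
      simp [hg y]
    · have h1 : ¬ j + 1 ≤ k := by omega
      simp only [h1, h.not_ge, if_false]
      rw [show j + 1 - k = (j - k) + 1 by omega, Function.iterate_succ_apply']
      exact hg _
  · simp [proj]

end

section

variable {T : Type} [MetricSpace T] {f : T → T}

noncomputable instance : MetricSpace (InvLim f) :=
  letI : TopologicalSpace (InvLim f) :=
    inferInstanceAs (TopologicalSpace {x : ℕ → T // ∀ k, f (x (k + 1)) = x k})
  haveI : TopologicalSpace.MetrizableSpace (InvLim f) :=
    Topology.IsEmbedding.metrizableSpace (Y := ℕ → T) (f := Subtype.val)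
      (Topology.IsEmbedding.subtypeVal (p := fun x : ℕ → T => ∀ k, f (x (k + 1)) = x k))
  TopologicalSpace.metrizableSpaceMetric (InvLim f)

theorem continuous_proj (k : ℕ) : Continuous (proj (f := f) k) :=
  (continuous_apply k).comp
    (continuous_subtype_val : Continuous fun x : {x : ℕ → T // ∀ k, f (x (k + 1)) = x k} => x.1)

theorem compactSpace [CompactSpace T] (hf : Continuous f) : CompactSpace (InvLim f) := by
  have h : IsClosed {x : ℕ → T | ∀ k, f (x (k + 1)) = x k} := by
    rw [Set.ofPred_forall]
    exact isClosed_iInter fun k =>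
      isClosed_eq (hf.comp (continuous_apply _)) (continuous_apply _)
  exact (isCompact_iff_compactSpace.1 h.isCompact :
    CompactSpace {x : ℕ → T // ∀ k, f (x (k + 1)) = x k})

end

/-- A nested sequence of closed relations on a compact space whose intersection lies in
an open relation is eventually contained in it. -/
theorem exists_forall_of_antitone {X : Type*} [TopologicalSpace X] [CompactSpace X]
    {R : ℕ → X → Prop} {P : X → Prop} (hR : ∀ k, IsClosed {x | R k x})
    (hmono : ∀ k x, R (k + 1) x → R k x) (hP : IsOpen {x | P x})
    (h : ∀ x, (∀ k, R k x) → P x) : ∃ k, ∀ x, R k x → P x := by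
  by_contra! hc
  obtain ⟨x, hx⟩ := IsCompact.nonempty_iInter_of_sequence_nonempty_isCompact_isClosed
    (fun k => {x | R k x} ∩ {x | P x}ᶜ) (fun k x hx => ⟨hmono k x hx.1, hx.2⟩)
    (fun k => hc k) (((hR 0).inter hP.isClosed_compl).isCompact)
    (fun k => (hR k).inter hP.isClosed_compl)
  rw [Set.mem_iInter] at hx
  exact (hx 0).2 (h x fun k => (hx k).1)

section

variable {T : Type} [MetricSpace T] [CompactSpace T] {f : T → T} {B : Type*} [PseudoMetricSpace B]

/-- A continuous map on the limit is nearly constant on the fibres of some projection. -/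
theorem exists_proj_fibres (hf : Continuous f) {H : InvLim f → B} (hH : Continuous H)
    {ε : ℝ} (hε : 0 < ε) : ∃ k, ∀ x y, proj k x = proj k y → dist (H x) (H y) < ε := by
  have := compactSpace hf
  obtain ⟨k, hk⟩ := exists_forall_of_antitone (X := InvLim f × InvLim f)
    (R := fun k p => proj k p.1 = proj k p.2) (P := fun p => dist (H p.1) (H p.2) < ε)
    (fun k => isClosed_eq ((continuous_proj k).comp continuous_fst)
      ((continuous_proj k).comp continuous_snd))
    (fun k p h => proj_eq_of_le k.le_succ h)
    (isOpen_lt ((hH.comp continuous_fst).dist (hH.comp continuous_snd)) continuous_const)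
    (fun p h => by rw [ext_proj h, dist_self]; exact hε)
  exact ⟨k, fun x y h => hk (x, y) h⟩

end

end InvLim

/-- If `H` varies by less than `ε` on the fibres of `g`, it does so on points whose images
under `g` are close enough. -/
theorem exists_dist_lt_of_fibres {X A B : Type*} [TopologicalSpace X] [CompactSpace X]
    [MetricSpace A] [PseudoMetricSpace B] {g : X → A} (hg : Continuous g) {H : X → B}
    (hH : Continuous H) {ε : ℝ} (h : ∀ x y, g x = g y → dist (H x) (H y) < ε) :
    ∃ η > 0, ∀ x y, dist (g x) (g y) ≤ η → dist (H x) (H y) < ε := by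
  obtain ⟨k, hk⟩ := InvLim.exists_forall_of_antitone (X := X × X)
    (R := fun k p => dist (g p.1) (g p.2) ≤ 1 / (k + 1 : ℝ))
    (P := fun p => dist (H p.1) (H p.2) < ε)
    (fun k => isClosed_le ((hg.comp continuous_fst).dist (hg.comp continuous_snd))
      continuous_const)
    (fun k p hp => hp.trans (by gcongr; simp))
    (isOpen_lt ((hH.comp continuous_fst).dist (hH.comp continuous_snd)) continuous_const)
    (fun p hp => h _ _ <| dist_le_zero.1 <|
      ge_of_tendsto' tendsto_one_div_add_atTop_nhds_zero_nat hp)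
  exact ⟨1 / (k + 1 : ℝ), Nat.one_div_pos_of_nat, fun x y hxy => hk (x, y) hxy⟩

namespace InvLim

variable {T : Type} [MetricSpace T] [CompactSpace T] {f : T → T}

theorem preconnectedSpace [PreconnectedSpace T] (hf : Continuous f)
    (hs : Function.Surjective f) : PreconnectedSpace (InvLim f) := by
  have := compactSpace hf
  rw [preconnectedSpace_iff_clopen]
  intro s hsc
  have hH : Continuous (s.indicator fun _ => (1 : ℝ)) := hsc.continuous_indicator continuous_const
  obtain ⟨k, hk⟩ := exists_proj_fibres hf hH one_pos
  have hiff : ∀ x y, proj k x = proj k y → x ∈ s → y ∈ s := by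
    intro x y hxy hx
    by_contra hy
    have := hk x y hxy
    simp [hx, hy] at this
  have hcompl : (proj k '' s)ᶜ = proj k '' sᶜ := by
    ext y
    constructor
    · intro hy
      obtain ⟨x, rfl⟩ := surjective_proj hs k y
      exact ⟨x, fun hx => hy ⟨x, hx, rfl⟩, rfl⟩
    · rintro ⟨x, hx, rfl⟩ ⟨z, hz, hzx⟩
      exact hx (hiff z x hzx hz)
  have hcl : ∀ t : Set (InvLim f), IsClosed t → IsClosed (proj k '' t) := fun t ht =>
    (ht.isCompact.image (continuous_proj k)).isClosed
  have hclopen : IsClopen (proj k '' s) :=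
    ⟨hcl s hsc.1, by rw [← isClosed_compl_iff, hcompl]; exact hcl _ hsc.2.isClosed_compl⟩
  rcases isClopen_iff.1 hclopen with h | h
  · exact Or.inl (Set.image_eq_empty.1 h)
  · refine Or.inr (Set.eq_univ_of_forall fun x => ?_)
    obtain ⟨z, hz, hzx⟩ := h.symm ▸ Set.mem_univ (proj k x)
    exact hiff z x hzx hz

theorem exists_image_ne_univ [Nonempty T] (hf : Continuous f) {H : Set (InvLim f)} (hH : IsClosed H)
    (h : H ≠ Set.univ) : ∃ k, proj k '' H ≠ Set.univ := by
  have := compactSpace hf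
  by_contra! hc
  refine h (Set.eq_univ_of_forall fun x => ?_)
  obtain ⟨k, hk⟩ := exists_forall_of_antitone (X := InvLim f)
    (R := fun k y => proj k y = proj k x ∧ y ∈ H) (P := fun _ => x ∈ H)
    (fun k => (isClosed_eq (continuous_proj k) continuous_const).inter hH)
    (fun k y hy => ⟨proj_eq_of_le k.le_succ hy.1, hy.2⟩) isOpen_const
    (fun y hy => by rw [← ext_proj fun k => (hy k).1]; exact (hy 0).2)
  obtain ⟨y, hy, hyx⟩ := (hc k).symm ▸ Set.mem_univ (proj k x)
  exact hk y ⟨hyx, hy⟩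

end InvLim

/-! ### The planar model -/

section

variable {n : ℕ}

/-- The `k`-th endpoint of the planar simple-`n`-od. -/
noncomputable def planeTip (n : ℕ) (k : Fin n) : ℂ :=
  Complex.exp (2 * Real.pi * Complex.I * ((k : ℕ) : ℂ) / (n : ℂ))

theorem planeTip_eq_pow (k : Fin n) :
    planeTip n k = Complex.exp (2 * Real.pi * Complex.I / n) ^ (k : ℕ) := by
  rw [planeTip, ← Complex.exp_nat_mul]
  congr 1
  ring

/-- The planar realization of the simple-`n`-od. -/
noncomputable def toPlane (x : od n) : ℂ := ∑ k, (x.1 k : ℂ) * planeTip n k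

theorem toPlane_eq (x : od n) : toPlane x = ((‖x.1‖ : ℝ) : ℂ) * planeTip n (legOf x) := by
  rw [toPlane, Finset.sum_eq_single (legOf x)]
  · rw [eq_single_legOf x, Pi.single_eq_same, ← eq_single_legOf x]
  · intro j _ hj
    rw [eq_single_legOf x, Pi.single_eq_of_ne hj]
    simp
  · simp

theorem toPlane_mem (x : od n) : toPlane x ∈ simpleOdSet n :=
  ⟨‖x.1‖, legOf x, norm_mem_Icc x, (legOf x).2, toPlane_eq x⟩

theorem continuous_toPlane : Continuous (toPlane (n := n)) :=
  continuous_finsetSum _ fun k _ => (Complex.continuous_ofReal.comp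
    ((continuous_apply k).comp continuous_subtype_val)).mul continuous_const

variable [NeZero n]

theorem planeTip_injective : Function.Injective (planeTip n) := by
  intro i j h
  rw [planeTip_eq_pow, planeTip_eq_pow] at h
  exact Fin.ext ((Complex.isPrimitiveRoot_exp n (NeZero.ne n)).pow_inj i.2 j.2 h)

theorem norm_planeTip (k : Fin n) : ‖planeTip n k‖ = 1 := by
  rw [planeTip_eq_pow, norm_pow,
    (Complex.isPrimitiveRoot_exp n (NeZero.ne n)).norm'_eq_one (NeZero.ne n), one_pow]

theorem toPlane_injective : Function.Injective (toPlane (n := n)) := by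
  intro x y h
  rw [toPlane_eq, toPlane_eq] at h
  have hn := congrArg norm h
  simp only [norm_mul, norm_planeTip, mul_one, Complex.norm_real, norm_norm] at hn
  rw [← mk_legOf x, ← mk_legOf y, ← hn]
  rcases eq_or_ne ‖x.1‖ 0 with h0 | h0
  · rw [h0]
    exact mk_zero _ _
  · rw [← hn] at h
    rw [planeTip_injective (mul_left_cancel₀ (Complex.ofReal_ne_zero.2 h0) h)]

/-- The two models of the simple-`n`-od are homeomorphic. -/
noncomputable def planeHomeo : od n ≃ₜ simpleOdSet n :=
  (continuous_toPlane.subtype_mk toPlane_mem).homeoOfEquivCompactToT2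
    (f := Equiv.ofBijective (fun x => ⟨toPlane x, toPlane_mem x⟩)
      ⟨fun x y h => toPlane_injective (congrArg Subtype.val h), by
        rintro ⟨_, t, k, ht, hk, rfl⟩
        refine ⟨mk ⟨k, hk⟩ t, Subtype.ext ?_⟩
        change toPlane _ = _
        rw [toPlane, Finset.sum_eq_single ⟨k, hk⟩, coe_mk _ ht, Pi.single_eq_same, planeTip]
        · intro j _ hj
          rw [coe_mk _ ht, Pi.single_eq_of_ne hj]
          simp
        · simp⟩)

/-! ### The inverse limit is simple-`n`-od-like -/

theorem isLike_invLim {f : od n → od n} (hf : Continuous f) (hs : Function.Surjective f) :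
    IsLike (InvLim f) (simpleOdSet n) := by
  intro ε hε
  obtain ⟨k, hk⟩ := InvLim.exists_proj_fibres hf (H := id) continuous_id (half_pos hε)
  refine ⟨fun x => planeHomeo (InvLim.proj k x),
    planeHomeo.continuous.comp (InvLim.continuous_proj k),
    planeHomeo.surjective.comp (InvLim.surjective_proj hs k), fun y => ?_⟩
  refine lt_of_le_of_lt (Metric.diam_le_of_forall_dist_le (half_pos hε).le ?_) (half_lt_self hε)
  intro x hx z hz
  exact (hk x z (planeHomeo.injective (hx.trans hz.symm))).le

theorem surjective_bond (h2 : 2 ≤ n) : Function.Surjective (bond (n := n)) := fun y =>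
  let ⟨r, _, h⟩ := bond_surjective h2 y
  ⟨mk 0 r, h⟩

/-! ### Proper subcontinua of the inverse limit -/

theorem isArcSet_of_injOn {X : Type*} [TopologicalSpace X] [T2Space X] {A : Set X}
    (hc : IsCompact A) (hA : IsConnected A) (hnt : A.Nontrivial) {ψ : X → ℝ}
    (hψ : Continuous ψ) (hinj : Set.InjOn ψ A) : IsArcSet A := by
  have : CompactSpace A := isCompact_iff_compactSpace.1 hc
  have him := eq_Icc_of_connected_compact (hA.image ψ hψ.continuousOn) (hc.image hψ)
  set a := sInf (ψ '' A)
  set b := sSup (ψ '' A)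
  have hab : a < b := by
    obtain ⟨x, hx, y, hy, hxy⟩ := hnt
    have hx' := him ▸ Set.mem_image_of_mem ψ hx
    have hy' := him ▸ Set.mem_image_of_mem ψ hy
    by_contra hba
    refine hxy (hinj hx hy ?_)
    rw [Set.mem_Icc] at hx' hy'
    linarith
  have hmem : ∀ x : A, ψ x ∈ Set.Icc a b := fun x => him ▸ Set.mem_image_of_mem ψ x.2
  have hcont : Continuous fun x : A => (⟨ψ x, hmem x⟩ : Set.Icc a b) :=
    (hψ.comp continuous_subtype_val).subtype_mk _
  refine ⟨(hcont.homeoOfEquivCompactToT2 (f := Equiv.ofBijective _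
    ⟨fun x y h => Subtype.ext (hinj x.2 y.2 (congrArg Subtype.val h)), ?_⟩)).trans
    (iccHomeoI a b hab)⟩
  rintro ⟨t, ht⟩
  obtain ⟨x, hx, rfl⟩ := him.symm ▸ ht
  exact ⟨⟨x, hx⟩, rfl⟩

theorem image_bond_image_proj (k : ℕ) (A : Set (InvLim (bond (n := n)))) :
    bond '' (InvLim.proj (k + 1) '' A) = InvLim.proj k '' A := by
  rw [Set.image_image]
  exact Set.image_congr fun x _ => InvLim.map_proj k x

/-- All sufficiently late projections of a proper subcontinuum lie in cells. -/
theorem exists_forall_subset_cell (h2 : 2 ≤ n) {A : Set (InvLim (bond (n := n)))}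
    (hc : IsCompact A) (hA : IsConnected A) (hne : A ≠ Set.univ) :
    ∃ k₁, ∀ k ≥ k₁, ∃ i s, InvLim.proj k '' A ⊆ cell i s := by
  have hcon : ∀ k, IsConnected (InvLim.proj k '' A) := fun k =>
    hA.image _ (InvLim.continuous_proj k).continuousOn
  have hstep := fun k => image_bond_image_proj k A
  by_contra! hbad
  have htip : ∀ j, tip n ∈ InvLim.proj j '' A := by
    intro j
    obtain ⟨k, hk, hkc⟩ := hbad (j + 2)
    have hnd : ¬ Disjoint (InvLim.proj k '' A) (nodes n) := fun hd => by
      obtain ⟨i, s, h⟩ := exists_subset_cell (hcon k) hd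
      exact hkc i s h
    obtain ⟨x, hx, hxn⟩ := Set.not_disjoint_iff.1 hnd
    obtain ⟨d, rfl⟩ := Nat.exists_eq_add_of_le hk
    have hdown : ∀ d j, tip n ∈ InvLim.proj (j + d) '' A → tip n ∈ InvLim.proj j '' A := by
      intro d
      induction d with
      | zero => exact fun j h => h
      | succ d ih =>
        intro j h
        refine ih j ?_
        rw [← hstep]
        exact ⟨tip n, h, bond_tip h2⟩
    refine hdown d j ?_
    rw [← hstep, ← hstep]
    refine ⟨bond x, ⟨x, ?_, rfl⟩, bond_bond_of_mem_nodes h2 hxn⟩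
    rwa [show j + d + 1 + 1 = j + 2 + d by omega]
  have : Nonempty (od n) := ⟨tip n⟩
  obtain ⟨k₀, hk₀⟩ := InvLim.exists_image_ne_univ continuous_bond hc.isClosed hne
  obtain ⟨k, hk, hkc⟩ := hbad (k₀ + 2)
  have hsub := cell_subset_of_tip_mem (hcon k) (htip k) (hkc _ _)
  obtain ⟨d, rfl⟩ := Nat.exists_eq_add_of_le hk
  refine hk₀ (Set.eq_univ_of_forall fun y => ?_)
  have huniv : ∀ y, y ∈ InvLim.proj (k₀ + d) '' A := by
    intro y
    obtain ⟨x, hx, rfl⟩ := image_bond_bond_cell h2 y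
    rw [← hstep, ← hstep]
    refine ⟨bond x, ⟨x, ?_, rfl⟩, rfl⟩
    rw [show k₀ + d + 1 + 1 = k₀ + 2 + d by omega]
    exact hsub hx
  obtain ⟨z, hz⟩ := (surjective_bond h2).iterate d y
  obtain ⟨x, hx, rfl⟩ := huniv z
  exact ⟨x, hx, by rw [← hz, InvLim.iterate_proj]⟩

theorem isArcSet_of_ne_univ (h2 : 2 ≤ n) {A : Set (InvLim (bond (n := n)))}
    (hc : IsCompact A) (hA : IsConnected A) (hne : A ≠ Set.univ) (hnt : A.Nontrivial) :
    IsArcSet A := by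
  obtain ⟨k, hk⟩ := exists_forall_subset_cell h2 hc hA hne
  obtain ⟨i, s, hcell⟩ := hk k le_rfl
  have hinj : Set.InjOn (InvLim.proj k) A := by
    intro x hx y hy hxy
    have hup : ∀ d, InvLim.proj (k + d) x = InvLim.proj (k + d) y := by
      intro d
      induction d with
      | zero => exact hxy
      | succ d ih =>
        obtain ⟨i, s, h⟩ := hk (k + (d + 1)) (by omega)
        refine injOn_bond_cell h2 i s (h ⟨x, hx, rfl⟩) (h ⟨y, hy, rfl⟩) ?_
        rw [← add_assoc, InvLim.map_proj (k + d) x, InvLim.map_proj (k + d) y, ih]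
    exact InvLim.ext_proj fun j => InvLim.proj_eq_of_le (Nat.le_add_left j k) (hup j)
  refine isArcSet_of_injOn hc hA hnt (ψ := fun x => (InvLim.proj k x).1 i)
    ((continuous_apply i).comp (continuous_subtype_val.comp (InvLim.continuous_proj k))) ?_
  intro x hx y hy hxy
  refine hinj hx hy ?_
  obtain ⟨r, hr, hxr, -⟩ := hcell ⟨x, hx, rfl⟩
  obtain ⟨r', hr', hyr, -⟩ := hcell ⟨y, hy, rfl⟩
  simp only [hxr, hyr, coe_mk _ hr, coe_mk _ hr', Pi.single_eq_same] at hxy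
  rw [hxr, hyr, hxy]

end

/-! ### The inverse limit is not simple-`m`-od-like for `m < n` -/

/-- The grid cell of size `1 / M` containing a point. -/
noncomputable def gridCode {m : ℕ} (M : ℕ) (y : od m) : Fin m → ℕ := fun q => ⌊M * y.1 q⌋₊

section

variable {m : ℕ} {M : ℕ}

theorem gridCode_eq (y : od m) : gridCode M y = Pi.single (legOf y) ⌊M * ‖y.1‖⌋₊ := by
  funext q
  unfold gridCode
  by_cases h : q = legOf y
  · subst h
    rw [Pi.single_eq_same]
    conv_lhs => rw [eq_single_legOf y, Pi.single_eq_same]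
  · rw [Pi.single_eq_of_ne h, eq_single_legOf y, Pi.single_eq_of_ne h]
    simp

theorem near_gridCode (hM : 0 < M) {x y : od m} (h : dist x y < 1 / M) :
    Near (gridCode M x) (gridCode M y) := by
  have hM' : (0 : ℝ) < M := by exact_mod_cast hM
  rw [lt_div_iff₀ hM'] at h
  rw [gridCode_eq, gridCode_eq]
  rcases eq_or_ne (legOf x) (legOf y) with hl | hl
  · refine ⟨legOf y, _, _, by rw [hl], rfl, ?_, ?_⟩ <;>
      refine Nat.lt_succ_iff.1 ((Nat.floor_lt (by positivity)).2 ?_)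
    · have h1 := Nat.lt_floor_add_one (M * ‖y.1‖)
      have := (abs_le.1 (abs_norm_sub_le x y)).2
      push_cast
      nlinarith
    · have h1 := Nat.lt_floor_add_one (M * ‖x.1‖)
      have := (abs_le.1 (abs_norm_sub_le x y)).1
      push_cast
      nlinarith
  · have hx := (legOf_eq_or x y).resolve_left hl
    have hy := (legOf_eq_or y x).resolve_left hl.symm
    rw [dist_comm] at hy
    rw [Nat.floor_eq_zero.2 (by nlinarith), Nat.floor_eq_zero.2 (by nlinarith)]
    exact ⟨legOf x, 0, 0, rfl, by simp, by simp, by simp⟩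

theorem dist_le_of_gridCode_eq (hM : 0 < M) {x y : od m} (h : gridCode M x = gridCode M y) :
    dist x y ≤ 1 / M := by
  have hM' : (0 : ℝ) < M := by exact_mod_cast hM
  have hx0 : 0 ≤ M * ‖x.1‖ := by positivity
  have hy0 : 0 ≤ M * ‖y.1‖ := by positivity
  have hx1 := Nat.lt_floor_add_one (M * ‖x.1‖)
  have hy1 := Nat.lt_floor_add_one (M * ‖y.1‖)
  rw [gridCode_eq, gridCode_eq] at h
  rcases eq_or_ne (legOf x) (legOf y) with hl | hl
  · rw [hl] at h
    have h' := Pi.single_injective _ h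
    have hx2 := Nat.floor_le hx0
    have hy2 := Nat.floor_le hy0
    rw [h'] at hx1 hx2
    rw [dist_of_legOf_eq hl, abs_le, neg_le, le_div_iff₀ hM', le_div_iff₀ hM']
    constructor <;> linarith
  · have hx2 := congrFun h (legOf x)
    have hy2 := congrFun h (legOf y)
    rw [Pi.single_eq_same, Pi.single_eq_of_ne hl] at hx2
    rw [Pi.single_eq_same, Pi.single_eq_of_ne hl.symm] at hy2
    rw [hx2] at hx1
    rw [← hy2] at hy1
    refine dist_le_of_norm_le ?_ ?_ <;> rw [le_div_iff₀ hM']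
    · push_cast at hx1
      linarith
    · push_cast at hy1
      linarith

end

/-- In a preconnected set, any two points are joined by a chain of small steps. -/
theorem reflTransGen_of_isPreconnected {X : Type*} [PseudoMetricSpace X] {C : Set X}
    (hC : IsPreconnected C) {δ : ℝ} (hδ : 0 < δ) {x y : X} (hx : x ∈ C) (hy : y ∈ C) :
    Relation.ReflTransGen (fun x y => dist x y < δ ∧ x ∈ C ∧ y ∈ C) x y := by
  have : Std.Symm fun x y : X => dist x y < δ ∧ x ∈ C ∧ y ∈ C :=
    ⟨fun x y hxy => ⟨by rw [dist_comm]; exact hxy.1, hxy.2.2, hxy.2.1⟩⟩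
  refine hC.induction₂ _ (fun x hx => ?_) (fun _ _ _ _ _ _ => Relation.ReflTransGen.trans)
    (fun x y _ _ => symm) hx hy
  filter_upwards [self_mem_nhdsWithin, mem_nhdsWithin_of_mem_nhds (Metric.ball_mem_nhds x hδ)]
    with y hy hxy
  exact Relation.ReflTransGen.single ⟨by rwa [dist_comm], hx, hy⟩

section

variable {n m : ℕ} [NeZero n]

theorem dist_iterate_le_of_succ (hn : 3 ≤ n) (hm : m < n) {φ : od n → Fin m → ℕ}
    {adj : od n → od n → Prop} {j : ℕ} (hsymm : ∀ p q, adj p q → adj q p)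
    (hnear : ∀ p q, adj p q → Near (φ p) (φ q)) (hconn : ∀ p q, Relation.ReflTransGen adj p q)
    (hstep : ∀ p q, adj p q → dist (bond^[j] p) (bond^[j] q) ≤ 1 / (16 * (200 * n)))
    (h : ∀ p q, φ p = φ q → dist (bond^[j + 1] p) (bond^[j + 1] q) ≤ 1 / 16) {p q : od n}
    (hpq : φ p = φ q) : dist (bond^[j] p) (bond^[j] q) ≤ 1 / 16 := by
  have hn3 : (3 : ℝ) ≤ n := by exact_mod_cast hn
  have hc : (0 : ℝ) < 200 * n := by linarith
  have hmul : ∀ {d : ℝ}, d ≤ 1 / (16 * (200 * n)) → 200 * n * d ≤ 1 / 16 := by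
    intro d hd
    have := mul_le_mul_of_nonneg_left hd hc.le
    rwa [show 200 * (n : ℝ) * (1 / (16 * (200 * n))) = 1 / 16 by field_simp] at this
  let S : Factorization n m (od n) :=
    { adj := adj
      φ := φ
      u := fun x => 200 * n * ‖(bond^[j] x).1‖
      leg := fun x => legOf (bond^[j] x)
      F := fun x => (bond^[j + 1] x).1
      symm := hsymm
      near := hnear
      conn := hconn
      u_nonneg := fun x => by positivity
      u_step := fun x y hxy => by
        rw [← mul_sub, abs_mul, abs_of_pos hc]
        exact hmul ((abs_norm_sub_le _ _).trans (hstep x y hxy))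
      leg_step := fun x y hxy =>
        (legOf_eq_or _ _).imp_right fun h => hmul (h.trans (hstep x y hxy))
      F_eq := fun x s hs => by
        rw [Function.iterate_succ_apply']
        exact coe_bond _ hs
      F_close := fun x y hxy => h x y hxy }
  have huc : |200 * n * ‖(bond^[j] p).1‖ - 200 * n * ‖(bond^[j] q).1‖| < n :=
    S.u_close hn hm hpq
  rcases le_or_gt (8 * (n : ℝ)) (200 * n * ‖(bond^[j] p).1‖) with hu | hu
  · rw [dist_of_legOf_eq (S.leg_eq hn hm hpq hu)]
    rw [← mul_sub, abs_mul, abs_of_pos hc] at huc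
    nlinarith
  · rw [abs_lt] at huc
    refine dist_le_of_norm_le ?_ ?_ <;> nlinarith

theorem false_of_small_fibres_invLim (hn : 3 ≤ n) (hm : m < n)
    {g : InvLim (bond (n := n)) → od m} (hg : Continuous g)
    (h : ∀ x y, g x = g y → dist (InvLim.proj 0 x) (InvLim.proj 0 y) < 1 / 16) : False := by
  have := InvLim.compactSpace (continuous_bond (n := n))
  obtain ⟨η, hη, hgη⟩ := exists_dist_lt_of_fibres hg (InvLim.continuous_proj 0) h
  obtain ⟨M, hMη⟩ := exists_nat_one_div_lt hη
  have hM : 0 < M + 1 := M.succ_pos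
  have hM1 : (0 : ℝ) < 1 / ((M + 1 : ℕ) : ℝ) := by positivity
  obtain ⟨k, hk⟩ := InvLim.exists_proj_fibres continuous_bond hg hM1
  obtain ⟨θ, hθ, hgθ⟩ := exists_dist_lt_of_fibres (InvLim.continuous_proj k) hg hk
  obtain ⟨σ, hσ⟩ :=
    (InvLim.surjective_proj (surjective_bond (n := n) (by omega)) k).hasRightInverse
  have hn3 : (3 : ℝ) ≤ n := by exact_mod_cast hn
  have hunif : ∃ δ > 0, ∀ j < k, ∀ p q : od n, dist p q < δ →
      dist (bond^[j] p) (bond^[j] q) ≤ 1 / (16 * (200 * n)) := by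
    have hpos : (0 : ℝ) < 1 / (16 * (200 * n)) := by positivity
    have huc : ∀ j, UniformContinuous ((bond (n := n))^[j]) := fun j =>
      CompactSpace.uniformContinuous_of_continuous (continuous_bond.iterate j)
    generalize k = k'
    induction k' with
    | zero => exact ⟨1, one_pos, fun j hj => absurd hj j.not_lt_zero⟩
    | succ k' ih =>
      obtain ⟨δ₁, h₁, hd₁⟩ := ih
      obtain ⟨δ₂, h₂, hd₂⟩ := Metric.uniformContinuous_iff.1 (huc k') _ hpos
      refine ⟨min δ₁ δ₂, lt_min h₁ h₂, fun j hj p q hpq => ?_⟩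
      rcases Nat.lt_succ_iff_lt_or_eq.1 hj with hj | rfl
      · exact hd₁ j hj p q (hpq.trans_le (min_le_left _ _))
      · exact (hd₂ (hpq.trans_le (min_le_right _ _))).le
  obtain ⟨δ, hδ, hd⟩ := hunif
  set φ : od n → Fin m → ℕ := fun p => gridCode (M + 1) (g (σ p)) with hφ
  let adj : od n → od n → Prop := fun p q => dist p q < min δ θ
  have hnear : ∀ p q, adj p q → Near (φ p) (φ q) := fun p q hpq =>
    near_gridCode hM (hgθ _ _ (by
      rw [hσ, hσ]
      exact (hpq.trans_le (min_le_right _ _)).le))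
  have hchain : ∀ C : Set (od n), IsPreconnected C → ∀ x ∈ C, ∀ y ∈ C,
      Relation.ReflTransGen (fun x y => adj x y ∧ x ∈ C ∧ y ∈ C) x y := fun C hC x hx y hy =>
    reflTransGen_of_isPreconnected hC (lt_min hδ hθ) hx hy
  have hclose : ∀ i ≤ k, ∀ p q, φ p = φ q →
      dist (bond^[k - i] p) (bond^[k - i] q) ≤ 1 / 16 := by
    intro i
    induction i with
    | zero =>
      intro _ p q hpq
      have h0 := hgη (σ p) (σ q) ((dist_le_of_gridCode_eq hM hpq).trans (by
        push_cast
        exact hMη.le))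
      have e : ∀ x : InvLim (bond (n := n)), bond^[k] (InvLim.proj k x) = InvLim.proj 0 x := by
        intro x
        have := InvLim.iterate_proj k 0 x
        rwa [zero_add] at this
      rw [← e, ← e, hσ, hσ] at h0
      exact h0.le
    | succ i ih =>
      intro hi p q hpq
      have ih' := ih (by omega)
      rw [show k - i = k - (i + 1) + 1 by omega] at ih'
      refine dist_iterate_le_of_succ hn hm (adj := adj)
        (fun p q hpq => by simpa only [adj, dist_comm] using hpq) hnear (fun p q => ?_)
        (fun p q hpq => hd _ (by omega) p q (hpq.trans_le (min_le_left _ _))) ih' hpq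
      exact Relation.ReflTransGen.mono (fun _ _ h => h.1)
        _ _ (hchain Set.univ isPreconnected_univ p trivial q trivial)
  refine false_of_small_fibres hn hm (fun p => ⟨_, _, gridCode_eq _⟩) hnear hchain
    fun p q hpq => ?_
  have := hclose k le_rfl p q hpq
  rwa [Nat.sub_self] at this

theorem not_isLike_invLim (hn : 3 ≤ n) (hm : m < n) (hm0 : m ≠ 0) :
    ¬ IsLike (InvLim (bond (n := n))) (simpleOdSet m) := by
  intro hlike
  have : NeZero m := ⟨hm0⟩
  have := InvLim.compactSpace (continuous_bond (n := n))
  obtain ⟨δ, hδ, hd⟩ := Metric.uniformContinuous_iff.1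
    (CompactSpace.uniformContinuous_of_continuous
      (InvLim.continuous_proj (f := bond (n := n)) 0)) (1 / 16) (by norm_num)
  obtain ⟨g, hg, -, hdiam⟩ := hlike δ hδ
  refine false_of_small_fibres_invLim hn hm (g := fun x => planeHomeo.symm (g x))
    (planeHomeo.symm.continuous.comp hg) fun x y hxy => hd ?_
  refine (Metric.dist_le_diam_of_mem (s := g ⁻¹' {g y}) ?_ ?_ rfl).trans_lt (hdiam (g y))
  · exact isCompact_univ.isBounded.subset (Set.subset_univ _)
  · exact planeHomeo.symm.injective hxy

end

end SimpleOd

/-- For every integer `n ≥ 3` there is a continuum `K` which is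
simple-`n`-od-like, is not simple-`(n-1)`-od-like, and each of whose proper
nondegenerate subcontinua is an arc. -/
theorem statement4 (n : ℕ) (hn : 3 ≤ n) :
    ∃ (K : Type) (_ : MetricSpace K), CompactSpace K ∧ ConnectedSpace K ∧ Nonempty K ∧
      IsLike K (simpleOdSet n) ∧ ¬ IsLike K (simpleOdSet (n - 1)) ∧
      ∀ A : Set K, IsCompact A → IsConnected A → A ≠ Set.univ → A.Nontrivial →
        IsArcSet A := by
  have : NeZero n := ⟨by omega⟩
  have h2 : 2 ≤ n := by omega
  have hs := SimpleOd.surjective_bond h2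
  have : Nonempty (SimpleOd.InvLim (SimpleOd.bond (n := n))) :=
    (SimpleOd.InvLim.surjective_proj hs 0 (SimpleOd.tip n)).nonempty
  have := SimpleOd.InvLim.preconnectedSpace SimpleOd.continuous_bond hs
  exact ⟨SimpleOd.InvLim (SimpleOd.bond (n := n)), inferInstance,
    SimpleOd.InvLim.compactSpace SimpleOd.continuous_bond, ⟨inferInstance⟩, inferInstance,
    SimpleOd.isLike_invLim SimpleOd.continuous_bond hs,
    SimpleOd.not_isLike_invLim hn (by omega) (by omega),
    fun A hc hA hne hnt => SimpleOd.isArcSet_of_ne_univ h2 hc hA hne hnt⟩
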